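/- Fix a real α > −1 and an integer n ≥ 1. For every continuous function f : ℝⁿ → ℝ with compact support contained in (0,∞)ⁿ, lim_{N→∞} (16N²)^{−n} ∫_{ℝⁿ} f(t₁,…,tₙ) · R_n^{θ,(N+α)/4}( t₁/(16N²), …, tₙ/(16N²) ) dt₁⋯dtₙ = ∫_{ℝⁿ} f(t₁,…,tₙ) · det[ K_{J_α}(tᵢ,tⱼ) ]_{i,j=1}^{n} dt₁⋯dtₙ. (Hard-edge universality of the bounded trace Laguerre unitary ensemble: the Bessel-kernel limit.) -/

import Mathlib

open MeasureTheory Filter Topology Finset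
open scoped Real Classical

noncomputable section

namespace RMT

/-- Extend a finite tuple by zero. -/
def extFun {n : ℕ} (t : Fin n → ℝ) : ℕ → ℝ := fun k => if h : k < n then t ⟨k, h⟩ else 0

/-- Squared Vandermonde determinant ∏_{i<j} (x_j - x_i)². -/
def vdm2 {N : ℕ} (x : Fin N → ℝ) : ℝ :=
  ∏ p ∈ Finset.univ.filter (fun p : Fin N × Fin N => p.1 < p.2), (x p.2 - x p.1) ^ 2

/-- Laguerre weight ∏ xᵢ^α (real power). -/
def lagWeight (α : ℝ) {N : ℕ} (x : Fin N → ℝ) : ℝ := ∏ i, x i ^ α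

/-- Partition function of the fixed trace LUE:
`Z_δ^r = r^{N(N+α)} ∏_{j=1}^N Γ(1+j)Γ(α+j) / Γ(N(N+α))`. -/
def ftlueZ (α : ℝ) (N : ℕ) (r : ℝ) : ℝ :=
  r ^ ((N : ℝ) * ((N : ℝ) + α)) *
    (∏ j ∈ Finset.range N, Real.Gamma (1 + ((j : ℝ) + 1)) * Real.Gamma (α + ((j : ℝ) + 1))) /
      Real.Gamma ((N : ℝ) * ((N : ℝ) + α))

/-- The full eigenvalue vector for the fixed trace LUE: the first `n` coordinates are the fixed
arguments `t`, the next `N-1-n` coordinates are the integration variables `y`, and the last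
coordinate is `r - ∑ t - ∑ y`. -/
def ftlueVec (N n : ℕ) (r : ℝ) (t : Fin n → ℝ) (y : Fin (N - 1 - n) → ℝ) : Fin N → ℝ :=
  fun i =>
    if (i : ℕ) < n then extFun t (i : ℕ)
    else if (i : ℕ) < N - 1 then extFun y ((i : ℕ) - n)
    else r - (∑ j, t j) - (∑ k, y k)

/-- `n`-point correlation function of the fixed trace LUE (FTLUE) with trace `r`. -/
def ftlueR (α : ℝ) (N n : ℕ) (r : ℝ) (t : Fin n → ℝ) : ℝ :=
  if (∀ i, 0 ≤ t i) ∧ (∑ i, t i) ≤ r then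
    ((N.factorial : ℝ) / ((N - n).factorial : ℝ)) / ftlueZ α N r *
      ∫ y : Fin (N - 1 - n) → ℝ,
        (if (∀ k, 0 ≤ y k) ∧ (∑ i, t i) + (∑ k, y k) ≤ r then
          vdm2 (ftlueVec N n r t y) * lagWeight α (ftlueVec N n r t y) else 0)
  else 0

/-- Full eigenvalue vector for ensembles where all of `x_{n+1},…,x_N` are integrated. -/
def fullVec (N n : ℕ) (t : Fin n → ℝ) (y : Fin (N - n) → ℝ) : Fin N → ℝ :=
  fun i => if (i : ℕ) < n then extFun t (i : ℕ) else extFun y ((i : ℕ) - n)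

/-- Partition function of the bounded trace LUE. -/
def btlueZ (α : ℝ) (N : ℕ) (r : ℝ) : ℝ :=
  ∫ x : Fin N → ℝ,
    (if (∀ i, 0 ≤ x i) ∧ (∑ i, x i) ≤ r then vdm2 x * lagWeight α x else 0)

/-- `n`-point correlation function of the bounded trace LUE (BTLUE). -/
def btlueR (α : ℝ) (N n : ℕ) (r : ℝ) (t : Fin n → ℝ) : ℝ :=
  if ∀ i, 0 ≤ t i then
    ((N.factorial : ℝ) / ((N - n).factorial : ℝ)) / btlueZ α N r *
      ∫ y : Fin (N - n) → ℝ,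
        (if (∀ k, 0 ≤ y k) ∧ (∑ i, t i) + (∑ k, y k) ≤ r then
          vdm2 (fullVec N n t y) * lagWeight α (fullVec N n t y) else 0)
  else 0

/-- Partition function of the LUE with scale `s`. -/
def lueZ (α : ℝ) (N : ℕ) (s : ℝ) : ℝ :=
  s ^ ((N : ℝ) * ((N : ℝ) + α)) *
    ∏ j ∈ Finset.range N, Real.Gamma (1 + ((j : ℝ) + 1)) * Real.Gamma (α + ((j : ℝ) + 1))

/-- Joint eigenvalue density of the LUE with scale `s`. -/
def luePdf (α : ℝ) (N : ℕ) (s : ℝ) (x : Fin N → ℝ) : ℝ :=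
  if ∀ i, 0 ≤ x i then
    (1 / lueZ α N s) * vdm2 x * ∏ i, x i ^ α * Real.exp (-(x i) / s)
  else 0

/-- `n`-point correlation function of the LUE with scale `s`. -/
def lueR (α : ℝ) (N n : ℕ) (s : ℝ) (t : Fin n → ℝ) : ℝ :=
  ((N.factorial : ℝ) / ((N - n).factorial : ℝ)) *
    ∫ y : Fin (N - n) → ℝ,
      (if ∀ k, 0 ≤ y k then luePdf α N s (fullVec N n t y) else 0)

/-- Gamma(N(N+α),1) density. -/
def gammaDens (α : ℝ) (N : ℕ) (x : ℝ) : ℝ :=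
  if 0 ≤ x then
    Real.exp (-x) * x ^ ((N : ℝ) * ((N : ℝ) + α) - 1) / Real.Gamma ((N : ℝ) * ((N : ℝ) + α))
  else 0

/-- Sine kernel. -/
def Ksin (u v : ℝ) : ℝ :=
  if u = v then 1 else Real.sin (π * (u - v)) / (π * (u - v))

/-- Marchenko–Pastur density. -/
def psiMP (x : ℝ) : ℝ :=
  if 0 < x ∧ x ≤ 1 then (2 / π) * Real.sqrt ((1 - x) / x) else 0

/-- Airy function, as a convergent improper integral. -/
def Ai (x : ℝ) : ℝ :=
  limUnder atTop (fun T : ℝ => (1 / π) * ∫ t in (0 : ℝ)..T, Real.cos (t ^ 3 / 3 + x * t))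

/-- Airy kernel. -/
def KAiry (u v : ℝ) : ℝ :=
  if u = v then (deriv Ai u) ^ 2 - u * (Ai u) ^ 2
  else (deriv Ai u * Ai v - deriv Ai v * Ai u) / (u - v)

/-- Bessel function of the first kind of (real) index `α`, as a power series. -/
def besselJ (α : ℝ) (x : ℝ) : ℝ :=
  ∑' m : ℕ,
    ((-1 : ℝ) ^ m / ((m.factorial : ℝ) * Real.Gamma ((m : ℝ) + α + 1))) *
      (x / 2) ^ (2 * (m : ℝ) + α)

/-- Bessel kernel off the diagonal. -/
def KBesselOff (α : ℝ) (u v : ℝ) : ℝ :=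
  (besselJ α (Real.sqrt u) * Real.sqrt v * deriv (besselJ α) (Real.sqrt v) -
      besselJ α (Real.sqrt v) * Real.sqrt u * deriv (besselJ α) (Real.sqrt u)) /
    (2 * (u - v))

/-- Bessel kernel, extended to the diagonal by its limiting value. -/
def KBessel (α : ℝ) (u v : ℝ) : ℝ :=
  if u = v then limUnder (𝓝[≠] u) (fun w => KBesselOff α u w) else KBesselOff α u v

/-- Orthonormal polynomials for the weight `x^α e^{-x}` on `(0,∞)`, at complex arguments. -/
def hkC (α : ℝ) (k : ℕ) (z : ℂ) : ℂ :=
  (Real.sqrt (Real.Gamma ((k : ℝ) + 1) / Real.Gamma ((k : ℝ) + α + 1)) : ℂ) *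
    ∑ j ∈ Finset.range (k + 1),
      (-1 : ℂ) ^ (k - j) *
        ((Real.Gamma ((k : ℝ) + α + 1) /
            (Real.Gamma ((j : ℝ) + α + 1) * ((k - j).factorial : ℝ) * (j.factorial : ℝ)) : ℝ) : ℂ) *
        z ^ j

/-- `φ_k(z) = z^{α/2} e^{-z/2} h_k(z)` (principal branch). -/
def phikC (α : ℝ) (k : ℕ) (z : ℂ) : ℂ :=
  z ^ ((α : ℂ) / 2) * Complex.exp (-z / 2) * hkC α k z

/-- Correlation kernel `K_N(z,w) = ∑_{k<N} φ_k(z) φ_k(w)`. -/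
def KNC (α : ℝ) (N : ℕ) (z w : ℂ) : ℂ := ∑ k ∈ Finset.range N, phikC α k z * phikC α k w

/-- Rescaled kernel `K̃_N(z,w,s) = s⁻¹ K_N(z/s, w/s)`. -/
def KNS (α : ℝ) (N : ℕ) (z w s : ℂ) : ℂ := s⁻¹ * KNC α N (z / s) (w / s)

/-- `Λ(H) = 1 + iH`. -/
def Lam (H : ℝ) : ℂ := 1 + Complex.I * (H : ℂ)

/-- Analytic continuation `ψ̂` of the Marchenko–Pastur density to the upper half plane,
with boundary values `ψ` on the reals. -/
def psihat (z : ℂ) : ℂ :=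
  if z.im = 0 then (psiMP z.re : ℂ)
  else (2 / (Complex.I * (π : ℂ))) * (z - 1) ^ ((1 : ℂ) / 2) / z ^ ((1 : ℂ) / 2)

/-- Characteristic function `φ_N(y) = e^{iy(N+α)} (1+iy/N)^{-N(N+α)}` (principal branch). -/
def phiN (α : ℝ) (N : ℕ) (y : ℝ) : ℂ :=
  Complex.exp (Complex.I * (y : ℂ) * (((N : ℝ) + α : ℝ) : ℂ)) *
    (1 + Complex.I * (y : ℂ) / (N : ℂ)) ^ (-((((N : ℝ) * ((N : ℝ) + α) : ℝ) : ℂ)))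

end RMT


namespace RMT

lemma gamma_ratio_unit (c : ℝ) (h0 : 0 ≤ c) (h1 : c ≤ 1) :
    Tendsto (fun x : ℝ => Real.Gamma (x + c) / (Real.Gamma x * x ^ c)) atTop (𝓝 1) := by
  have hlow : Tendsto (fun x : ℝ => (x / (x + c)) ^ (1 - c)) atTop (𝓝 1) := by
    have h : Tendsto (fun x : ℝ => x / (x + c)) atTop (𝓝 1) := by
      have : Tendsto (fun x : ℝ => 1 / (1 + c / x)) atTop (𝓝 (1 / (1 + 0))) := by
        refine Tendsto.div tendsto_const_nhds (tendsto_const_nhds.add ?_) (by norm_num)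
        exact tendsto_const_nhds.div_atTop tendsto_id
      simp only [add_zero, div_one] at this
      refine this.congr' ?_
      filter_upwards [eventually_gt_atTop 0] with x hx
      field_simp
    have := h.rpow_const (p := 1 - c) (Or.inl one_ne_zero)
    simpa using this
  refine tendsto_of_tendsto_of_tendsto_of_le_of_le' hlow tendsto_const_nhds ?_ ?_
  · filter_upwards [eventually_gt_atTop 0] with x hx
    have hG : 0 < Real.Gamma x := Real.Gamma_pos_of_pos hx
    have hxc : 0 < x + c := by linarith
    have hGc : 0 < Real.Gamma (x + c) := Real.Gamma_pos_of_pos hxc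
    rw [le_div_iff₀ (by positivity)]
    rcases eq_or_lt_of_le h0 with rfl | h0'
    · simp [hx.ne']
    rcases eq_or_lt_of_le h1 with rfl | h1'
    · simp [Real.Gamma_add_one hx.ne', mul_comm]
    have key := Real.Gamma_mul_add_mul_le_rpow_Gamma_mul_rpow_Gamma (s := x + c) (t := x + c + 1)
      (a := c) (b := 1 - c) hxc (by linarith) h0' (by linarith) (by ring)
    have e1 : c * (x + c) + (1 - c) * (x + c + 1) = x + 1 := by ring
    rw [e1, Real.Gamma_add_one hx.ne', Real.Gamma_add_one hxc.ne',
      Real.mul_rpow hxc.le hGc.le, mul_left_comm, ← Real.rpow_add hGc] at key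
    simp only [add_sub_cancel, Real.rpow_one] at key
    rw [Real.div_rpow hx.le hxc.le, div_mul_eq_mul_div, div_le_iff₀ (by positivity)]
    calc x ^ (1 - c) * (Real.Gamma x * x ^ c) = (x ^ (1 - c) * x ^ c) * Real.Gamma x := by ring
      _ = x * Real.Gamma x := by rw [← Real.rpow_add hx]; simp
      _ ≤ _ := by linarith
  · filter_upwards [eventually_gt_atTop 0] with x hx
    have hG : 0 < Real.Gamma x := Real.Gamma_pos_of_pos hx
    rw [div_le_one (by positivity)]
    rcases eq_or_lt_of_le h0 with rfl | h0'
    · simp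
    rcases eq_or_lt_of_le h1 with rfl | h1'
    · simp [Real.Gamma_add_one hx.ne', mul_comm]
    have key := Real.Gamma_mul_add_mul_le_rpow_Gamma_mul_rpow_Gamma (s := x) (t := x + 1)
      (a := 1 - c) (b := c) hx (by linarith) (by linarith) h0' (by ring)
    have e1 : (1 - c) * x + c * (x + 1) = x + c := by ring
    rw [e1, Real.Gamma_add_one hx.ne', Real.mul_rpow hx.le hG.le, mul_left_comm,
      ← Real.rpow_add hG] at key
    simp only [sub_add_cancel, Real.rpow_one] at key
    linarith

lemma tendsto_add_div_self (c : ℝ) : Tendsto (fun x : ℝ => (x + c) / x) atTop (𝓝 1) := by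
  have : Tendsto (fun x : ℝ => 1 + c / x) atTop (𝓝 (1 + 0)) :=
    tendsto_const_nhds.add (tendsto_const_nhds.div_atTop tendsto_id)
  rw [add_zero] at this
  refine this.congr' ?_
  filter_upwards [eventually_gt_atTop 0] with x hx
  field_simp

lemma gamma_ratio_succ (c : ℝ)
    (h : Tendsto (fun x : ℝ => Real.Gamma (x + c) / (Real.Gamma x * x ^ c)) atTop (𝓝 1)) :
    Tendsto (fun x : ℝ => Real.Gamma (x + (c + 1)) / (Real.Gamma x * x ^ (c + 1))) atTop (𝓝 1) := by
  have := h.mul (tendsto_add_div_self c)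
  rw [one_mul] at this
  refine this.congr' ?_
  filter_upwards [eventually_gt_atTop 0, eventually_gt_atTop (-c)] with x hx hx'
  have : x + c ≠ 0 := by linarith
  rw [← add_assoc, Real.Gamma_add_one this, Real.rpow_add_one hx.ne']
  field_simp

lemma gamma_ratio_pred (c : ℝ)
    (h : Tendsto (fun x : ℝ => Real.Gamma (x + c) / (Real.Gamma x * x ^ c)) atTop (𝓝 1)) :
    Tendsto (fun x : ℝ => Real.Gamma (x + (c - 1)) / (Real.Gamma x * x ^ (c - 1))) atTop (𝓝 1) := by
  have := h.div (tendsto_add_div_self (c - 1)) one_ne_zero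
  rw [one_div_one] at this
  refine this.congr' ?_
  filter_upwards [eventually_gt_atTop 0, eventually_gt_atTop (-c + 1)] with x hx hx'
  have h1 : x + (c - 1) ≠ 0 := by linarith
  have hG : 0 < Real.Gamma x := Real.Gamma_pos_of_pos hx
  have e : x + c = x + (c - 1) + 1 := by ring
  simp only [Pi.div_apply]
  rw [e, Real.Gamma_add_one h1, Real.rpow_sub_one hx.ne']
  have := Real.rpow_pos_of_pos hx c
  field_simp

lemma gamma_ratio (c : ℝ) :
    Tendsto (fun x : ℝ => Real.Gamma (x + c) / (Real.Gamma x * x ^ c)) atTop (𝓝 1) := by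
  have : ∀ z : ℤ, Tendsto (fun x : ℝ => Real.Gamma (x + (Int.fract c + z)) /
      (Real.Gamma x * x ^ (Int.fract c + z))) atTop (𝓝 1) := by
    intro z
    induction z using Int.induction_on with
    | zero => simpa using gamma_ratio_unit _ (Int.fract_nonneg c) (Int.fract_lt_one c).le
    | succ i hi =>
      have := gamma_ratio_succ _ hi
      simpa [add_assoc] using this
    | pred i hi =>
      have := gamma_ratio_pred _ hi
      simpa [add_assoc, sub_eq_add_neg] using this
  have := this ⌊c⌋
  simpa [Int.fract_add_floor] using this

/-- coefficients appearing in the Laguerre kernel -/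
def qk (α : ℝ) (a b k : ℕ) : ℝ :=
  (k.descFactorial a : ℝ) * (k.descFactorial b : ℝ) * Real.Gamma (k + α + 1) / (k.factorial : ℝ)

lemma qk_nonneg {α : ℝ} (hα : -1 < α) (a b k : ℕ) : 0 ≤ qk α a b k := by
  have : 0 < Real.Gamma (k + α + 1) :=
    Real.Gamma_pos_of_pos (by have : (0:ℝ) ≤ k := k.cast_nonneg; linarith)
  unfold qk; positivity

lemma desc_ratio (a : ℕ) :
    Tendsto (fun k : ℕ => (k.descFactorial a : ℝ) / ((k : ℝ) + 1) ^ a) atTop (𝓝 1) := by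
  induction a with
  | zero => simp
  | succ a ih =>
    have h1 : Tendsto (fun k : ℕ => (((k : ℝ) + 1) + (-(1 + (a : ℝ)))) / ((k : ℝ) + 1))
        atTop (𝓝 1) :=
      (tendsto_add_div_self (-(1 + (a : ℝ)))).comp
        (tendsto_atTop_add_const_right _ _ tendsto_natCast_atTop_atTop)
    have := h1.mul ih
    rw [one_mul] at this
    refine this.congr' ?_
    filter_upwards [eventually_ge_atTop a] with k hk
    rw [Nat.descFactorial_succ, Nat.cast_mul, Nat.cast_sub hk]
    field_simp
    ring

lemma qk_asymp (α : ℝ) (a b : ℕ) :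
    Tendsto (fun k : ℕ => qk α a b k / ((k : ℝ) + 1) ^ ((a : ℝ) + b + α)) atTop (𝓝 1) := by
  have h1 := (gamma_ratio α).comp
    (tendsto_atTop_add_const_right _ (1:ℝ) tendsto_natCast_atTop_atTop)
  have := ((desc_ratio a).mul (desc_ratio b)).mul h1
  simp only [one_mul] at this
  refine this.congr' ?_
  filter_upwards with k
  simp only [Function.comp]
  have hk : (0:ℝ) < (k:ℝ) + 1 := by positivity
  rw [Real.Gamma_nat_eq_factorial, Real.rpow_add hk, Real.rpow_add hk, Real.rpow_natCast,
    Real.rpow_natCast, qk]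
  have : (k:ℝ) + 1 + α = k + α + 1 := by ring
  rw [this]
  field_simp

lemma diff_asymp (p : ℝ) :
    Tendsto (fun k : ℕ => (((k : ℝ) + 1) ^ p - (k : ℝ) ^ p) / ((k : ℝ) + 1) ^ (p - 1))
      atTop (𝓝 p) := by
  have hd : HasDerivAt (fun x : ℝ => x ^ p) (p * 1 ^ (p - 1)) 1 :=
    Real.hasDerivAt_rpow_const (Or.inl one_ne_zero)
  rw [Real.one_rpow, mul_one, hasDerivAt_iff_tendsto_slope] at hd
  have hseq : Tendsto (fun k : ℕ => (k : ℝ) / ((k : ℝ) + 1)) atTop (𝓝[≠] 1) := by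
    rw [tendsto_nhdsWithin_iff]
    refine ⟨tendsto_natCast_div_add_atTop 1, Eventually.of_forall fun k => ?_⟩
    have : (0:ℝ) < (k:ℝ) + 1 := by positivity
    simp only [Set.mem_compl_iff, Set.mem_singleton_iff]
    rw [div_eq_one_iff_eq this.ne']
    linarith
  refine (hd.comp hseq).congr fun k => ?_
  have hk : (0:ℝ) < (k:ℝ) + 1 := by positivity
  simp only [Function.comp, slope_def_field, Real.one_rpow]
  rw [Real.div_rpow k.cast_nonneg hk.le, Real.rpow_sub_one hk.ne']
  have := Real.rpow_pos_of_pos hk p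
  have e : (k : ℝ) / (k + 1) - 1 = -1 / (k + 1) := by field_simp; ring
  rw [e]
  field_simp
  ring

lemma qsum_tendsto {α : ℝ} (hα : -1 < α) (a b : ℕ) :
    Tendsto (fun N : ℕ => (∑ k ∈ range N, qk α a b k) / (N : ℝ) ^ ((a : ℝ) + b + α + 1))
      atTop (𝓝 (1 / ((a : ℝ) + b + α + 1))) := by
  set p : ℝ := (a : ℝ) + b + α + 1 with hp
  have hp0 : 0 < p := by
    have : (0:ℝ) ≤ a := a.cast_nonneg
    have : (0:ℝ) ≤ b := b.cast_nonneg
    rw [hp]; linarith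
  set g : ℕ → ℝ := fun k => ((k : ℝ) + 1) ^ p - (k : ℝ) ^ p with hg
  have hg0 : ∀ k, 0 < g k := fun k => by
    simp only [hg, sub_pos]
    exact Real.rpow_lt_rpow k.cast_nonneg (by linarith) hp0
  have hsum : ∀ N, ∑ k ∈ range N, g k = (N : ℝ) ^ p := fun N => by
    have := Finset.sum_range_sub (fun k : ℕ => (k : ℝ) ^ p) N
    simp only [Nat.cast_add, Nat.cast_one, Nat.cast_zero, Real.zero_rpow hp0.ne', sub_zero] at this
    exact this
  have hratio : Tendsto (fun k => qk α a b k / g k) atTop (𝓝 (1 / p)) := by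
    have h1 := (qk_asymp α a b).div (diff_asymp p) hp0.ne'
    refine h1.congr fun k => ?_
    have hk : (0:ℝ) < (k:ℝ) + 1 := by positivity
    have e : (a : ℝ) + b + α = p - 1 := by rw [hp]; ring
    simp only [Pi.div_apply]
    rw [e]
    have := Real.rpow_pos_of_pos hk (p - 1)
    have := hg0 k
    simp only [hg] at this ⊢
    field_simp
  have hlo : (fun k => qk α a b k - g k / p) =o[atTop] g := by
    rw [Asymptotics.isLittleO_iff_tendsto (fun k hk => absurd hk (hg0 k).ne')]
    have : Tendsto (fun k => qk α a b k / g k - 1 / p) atTop (𝓝 0) := by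
      simpa using hratio.sub_const (1 / p)
    refine this.congr fun k => ?_
    have := (hg0 k).ne'
    field_simp
  have hN : Tendsto (fun N : ℕ => (N : ℝ) ^ p) atTop atTop :=
    (tendsto_rpow_atTop hp0).comp tendsto_natCast_atTop_atTop
  have h2 := hlo.sum_range (fun k => (hg0 k).le) (by simpa only [hsum] using hN)
  simp only [hsum] at h2
  have h3 := h2.tendsto_div_nhds_zero
  have h4 := h3.add_const (1 / p)
  rw [zero_add] at h4
  refine h4.congr' ?_
  filter_upwards [eventually_gt_atTop 0] with N hN
  have hN' : (0:ℝ) < (N:ℝ) ^ p := Real.rpow_pos_of_pos (by exact_mod_cast hN) _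
  rw [Finset.sum_sub_distrib, ← Finset.sum_div, hsum]
  field_simp
  ring

lemma qsum_le {α : ℝ} (hα : -1 < α) : ∃ C : ℝ, 0 < C ∧ ∀ N a b : ℕ, 1 ≤ N →
    (∑ k ∈ range N, qk α a b k) / (N : ℝ) ^ ((a : ℝ) + b + α + 1) ≤ C := by
  obtain ⟨C, hC⟩ := (qsum_tendsto hα 0 0).bddAbove_range
  refine ⟨max C 1, by positivity, fun N a b hN => le_trans ?_ (le_max_left C 1)⟩
  have hN0 : (0:ℝ) < N := by exact_mod_cast hN
  refine le_trans ?_ (hC ⟨N, rfl⟩)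
  have e : (N : ℝ) ^ ((a : ℝ) + b + α + 1) = (N:ℝ) ^ a * (N:ℝ) ^ b * (N:ℝ) ^ (α + 1) := by
    rw [add_assoc, Real.rpow_add hN0, Real.rpow_add hN0, Real.rpow_natCast, Real.rpow_natCast]
  have e0 : (N : ℝ) ^ (((0:ℕ) : ℝ) + ((0:ℕ):ℝ) + α + 1) = (N:ℝ) ^ (α + 1) := by simp
  rw [e]
  simp only [e0]
  have hNp := Real.rpow_pos_of_pos hN0 (α + 1)
  rw [div_le_div_iff₀ (by positivity) hNp]
  have : ∑ k ∈ range N, qk α a b k ≤ (N:ℝ) ^ a * (N:ℝ) ^ b * ∑ k ∈ range N, qk α 0 0 k := by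
    rw [Finset.mul_sum]
    refine Finset.sum_le_sum fun k hk => ?_
    have hkN : k ≤ N := (Finset.mem_range.mp hk).le
    have h1 : ∀ a, (k.descFactorial a : ℝ) ≤ (N:ℝ) ^ a := fun a => by
      have := (Nat.descFactorial_le_pow k a).trans (Nat.pow_le_pow_left hkN a)
      exact_mod_cast this
    have hG : 0 < Real.Gamma (k + α + 1) :=
      Real.Gamma_pos_of_pos (by have : (0:ℝ) ≤ k := k.cast_nonneg; linarith)
    simp only [qk, Nat.descFactorial_zero, Nat.cast_one, one_mul]
    rw [mul_div_assoc]
    exact mul_le_mul_of_nonneg_right (mul_le_mul (h1 a) (h1 b) (by positivity) (by positivity))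
      (by positivity)
  calc _ ≤ _ := mul_le_mul_of_nonneg_right this hNp.le
    _ = _ := by ring


/-- reduced Laguerre coefficients -/
def lc (α : ℝ) (k a : ℕ) : ℝ := (-1) ^ a * (k.choose a : ℝ) / Real.Gamma (a + α + 1)

lemma gpos {α : ℝ} (hα : -1 < α) (a : ℕ) : 0 < Real.Gamma (a + α + 1) :=
  Real.Gamma_pos_of_pos (by have : (0:ℝ) ≤ a := a.cast_nonneg; linarith)

lemma gamma_asc {x : ℝ} (hx : 0 < x) (j : ℕ) :
    Real.Gamma (x + j) = (ascPochhammer ℝ j).eval x * Real.Gamma x := by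
  induction j with
  | zero => simp
  | succ j ih =>
    have : x + j ≠ 0 := by positivity
    rw [ascPochhammer_succ_eval, Nat.cast_succ, ← add_assoc, Real.Gamma_add_one this, ih]
    ring

lemma alt_sum_asc (k j : ℕ) (y : ℝ) (hj : j ≤ k) :
    ∑ a ∈ range (k + 1), (-1 : ℝ) ^ a * (k.choose a : ℝ) * (ascPochhammer ℝ j).eval (y + a) =
      if j = k then (-1) ^ k * (k.factorial : ℝ) else 0 := by
  have h := fwdDiff_iter_eq_sum_shift (1:ℝ) (fun x => (ascPochhammer ℝ j).eval x) k y
  have e : ∑ a ∈ range (k + 1), (-1 : ℝ) ^ a * (k.choose a : ℝ) * (ascPochhammer ℝ j).eval (y + a)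
      = (-1) ^ k * ∑ a ∈ range (k + 1), ((-1 : ℤ) ^ (k - a) * k.choose a) •
        (ascPochhammer ℝ j).eval (y + a • (1:ℝ)) := by
    rw [Finset.mul_sum]
    refine Finset.sum_congr rfl fun a ha => ?_
    have hak : a ≤ k := by simpa [Nat.lt_succ_iff] using ha
    have : (-1:ℝ) ^ k * (-1) ^ (k - a) = (-1) ^ a := by
      rw [← pow_add]
      have : k + (k - a) = a + 2 * (k - a) := by omega
      rw [this, pow_add, pow_mul]; simp
    rw [← this]
    simp [zsmul_eq_mul, nsmul_eq_mul]
    ring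
  rw [e, ← h]
  rcases hj.lt_or_eq with hlt | rfl
  · have := Polynomial.fwdDiff_iter_eq_zero_of_degree_lt (P := ascPochhammer ℝ j) (n := k)
      (by rw [ascPochhammer_natDegree]; exact hlt)
    have := congrFun this y
    simp only [Pi.zero_apply] at this
    rw [if_neg hlt.ne, this, mul_zero]
  · have := Polynomial.fwdDiff_iter_degree_eq_factorial (ascPochhammer ℝ j)
    rw [ascPochhammer_natDegree, (monic_ascPochhammer ℝ j).leadingCoeff] at this
    have := congrFun this y
    rw [if_pos rfl, this]
    simp

lemma lG {α : ℝ} (hα : -1 < α) {N : ℕ} (k j : ℕ) (hk : k < N) (hj : j ≤ k) :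
    ∑ a : Fin N, lc α k a * Real.Gamma ((a : ℕ) + (j : ℝ) + α + 1) =
      if j = k then (-1) ^ k * (k.factorial : ℝ) else 0 := by
  rw [← alt_sum_asc k j (α + 1) hj, Fin.sum_univ_eq_sum_range
    (fun a => lc α k a * Real.Gamma (a + (j : ℝ) + α + 1)) N]
  symm
  rw [← Finset.sum_subset (Finset.range_subset_range.mpr hk)]
  · refine Finset.sum_congr rfl fun a _ => ?_
    have hp : (0:ℝ) < a + α + 1 := by have : (0:ℝ) ≤ a := a.cast_nonneg; linarith
    have e : (a:ℝ) + j + α + 1 = (a + α + 1) + j := by ring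
    have e2 : α + 1 + (a:ℝ) = a + α + 1 := by ring
    rw [e, gamma_asc hp, lc, e2]
    have := gpos hα a
    field_simp
  · intro a _ ha
    have : k < a := by simpa using ha
    simp [lc, Nat.choose_eq_zero_of_lt this]

/-- coefficients of the Laguerre kernel -/
def bc (α : ℝ) (N a b : ℕ) : ℝ :=
  (-1) ^ (a + b) / (Real.Gamma (a + α + 1) * Real.Gamma (b + α + 1) * a.factorial * b.factorial) *
    ∑ k ∈ range N, qk α a b k

def Bmat (α : ℝ) (N : ℕ) : Matrix (Fin N) (Fin N) ℝ := Matrix.of fun a b => bc α N a b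

def Gmat (α : ℝ) (N : ℕ) : Matrix (Fin N) (Fin N) ℝ :=
  Matrix.of fun a b => Real.Gamma ((a : ℕ) + ((b : ℕ) : ℝ) + α + 1)

def Lmat (α : ℝ) (N : ℕ) : Matrix (Fin N) (Fin N) ℝ := Matrix.of fun k a => lc α k a

def dvec (α : ℝ) (N : ℕ) : Fin N → ℝ := fun k =>
  Real.Gamma ((k : ℕ) + α + 1) / ((k : ℕ).factorial : ℝ)

lemma Bmat_eq (α : ℝ) (N : ℕ) :
    Bmat α N = (Lmat α N).transpose * Matrix.diagonal (dvec α N) * Lmat α N := by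
  ext a b
  rw [Matrix.mul_apply]
  simp only [Matrix.mul_diagonal]
  simp only [Bmat, Matrix.of_apply, Matrix.transpose_apply, Lmat, bc, dvec]
  rw [Fin.sum_univ_eq_sum_range (fun k => lc α k a * (Real.Gamma (k + α + 1) / (k.factorial : ℝ)) *
    lc α k b) N, Finset.mul_sum]
  refine Finset.sum_congr rfl fun k _ => ?_
  simp only [qk, lc, Nat.descFactorial_eq_factorial_mul_choose, Nat.cast_mul]
  have h1 : ((a : ℕ).factorial : ℝ) ≠ 0 := by positivity
  have h2 : ((b : ℕ).factorial : ℝ) ≠ 0 := by positivity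
  field_simp
  ring

lemma LG_apply {α : ℝ} (hα : -1 < α) (N : ℕ) (k j : Fin N) (h : j ≤ k) :
    (Lmat α N * Gmat α N) k j = if j = k then (-1) ^ (k:ℕ) * ((k : ℕ).factorial : ℝ) else 0 := by
  simp only [Matrix.mul_apply, Lmat, Gmat, Matrix.of_apply]
  rw [lG hα k j k.2 h]
  simp [Fin.ext_iff]

lemma LGL_of_le {α : ℝ} (hα : -1 < α) (N : ℕ) (k l : Fin N) (h : l ≤ k) :
    (Lmat α N * Gmat α N * (Lmat α N).transpose) k l =
      if l = k then (dvec α N k)⁻¹ else 0 := by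
  rw [Matrix.mul_apply]
  rw [Finset.sum_eq_single k]
  · rw [LG_apply hα N k k le_rfl]
    simp only [Matrix.transpose_apply, Lmat, Matrix.of_apply, lc, if_true]
    split_ifs with hlk
    · subst hlk
      simp only [Nat.choose_self, dvec]
      have : ((-1:ℝ) ^ (l:ℕ)) * (-1) ^ (l:ℕ) = 1 := by rw [← mul_pow]; simp
      have hg := (gpos hα l).ne'
      field_simp
      linear_combination this
    · have : (l:ℕ) < k := lt_of_le_of_ne h (by simpa [Fin.ext_iff] using hlk)
      simp [Nat.choose_eq_zero_of_lt this]
  · intro j _ hj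
    rcases lt_or_gt_of_ne hj with hlt | hgt
    · rw [LG_apply hα N k j hlt.le, if_neg hj, zero_mul]
    · have : (l:ℕ) < j := lt_of_le_of_lt h hgt
      simp [Lmat, lc, Nat.choose_eq_zero_of_lt this]
  · simp

lemma LGL {α : ℝ} (hα : -1 < α) (N : ℕ) :
    Lmat α N * Gmat α N * (Lmat α N).transpose = Matrix.diagonal (fun k => (dvec α N k)⁻¹) := by
  have hsym : (Lmat α N * Gmat α N * (Lmat α N).transpose).transpose =
      Lmat α N * Gmat α N * (Lmat α N).transpose := by
    have : (Gmat α N).transpose = Gmat α N := by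
      ext a b; simp [Gmat, add_comm ((a : ℕ) : ℝ)]
    simp [Matrix.transpose_mul, this, Matrix.mul_assoc]
  ext k l
  rw [Matrix.diagonal_apply]
  rcases le_total l k with h | h
  · rw [LGL_of_le hα N k l h]; simp [eq_comm]
  · rw [← hsym, Matrix.transpose_apply, LGL_of_le hα N l k h]
    split_ifs with hkl
    · subst hkl; rfl
    · rfl

lemma BG {α : ℝ} (hα : -1 < α) (N : ℕ) : Bmat α N * Gmat α N = 1 := by
  have h1 : (Lmat α N * Gmat α N) * ((Lmat α N).transpose * Matrix.diagonal (dvec α N)) = 1 := by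
    rw [← Matrix.mul_assoc, LGL hα, Matrix.diagonal_mul_diagonal]
    rw [← Matrix.diagonal_one]
    congr 1
    ext k
    have : dvec α N k ≠ 0 := by
      have := gpos hα k
      unfold dvec; positivity
    field_simp
  rw [mul_eq_one_comm] at h1
  rw [Bmat_eq, Matrix.mul_assoc, h1]


/-- polynomial Laguerre kernel -/
def kN (α : ℝ) (N : ℕ) (x y : ℝ) : ℝ := ∑ a : Fin N, ∑ b : Fin N, x ^ (a:ℕ) * Bmat α N a b * y ^ (b:ℕ)

def kdet (α : ℝ) (N : ℕ) {m : ℕ} (x : Fin m → ℝ) : ℝ :=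
  Matrix.det (Matrix.of fun i j : Fin m => kN α N (x i) (x j))

/-- Laguerre weight function -/
def wf (α : ℝ) (x : ℝ) : ℝ := if 0 ≤ x then x ^ α * Real.exp (-x) else 0

lemma wf_nonneg (α x : ℝ) : 0 ≤ wf α x := by
  unfold wf; split_ifs <;> positivity

lemma wf_meas (α : ℝ) : Measurable (wf α) := by
  unfold wf
  refine Measurable.ite (measurableSet_le measurable_const measurable_id) (by fun_prop) (by fun_prop)

lemma wf_pow_ae (α : ℝ) (j : ℕ) : (fun x => x ^ j * wf α x) =ᵐ[volume]
    (Set.Ioi (0:ℝ)).indicator (fun x => Real.exp (-x) * x ^ ((j:ℝ) + α + 1 - 1)) := by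
  have h0 : ∀ᵐ x : ℝ, x ≠ 0 := by
    rw [ae_iff]; simp
  filter_upwards [h0] with x hx
  rcases lt_or_gt_of_ne hx with h | h
  · rw [Set.indicator_of_notMem (by simpa using h.le)]
    simp [wf, not_le.mpr h]
  · rw [Set.indicator_of_mem (by simpa using h)]
    simp only [wf, h.le, if_true, add_sub_cancel_right]
    rw [Real.rpow_add h, Real.rpow_natCast]; ring

lemma wf_pow_int {α : ℝ} (hα : -1 < α) (j : ℕ) : Integrable (fun x => x ^ j * wf α x) := by
  have := Real.GammaIntegral_convergent (s := (j:ℝ) + α + 1)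
    (by have : (0:ℝ) ≤ j := j.cast_nonneg; linarith)
  rw [← integrable_indicator_iff measurableSet_Ioi] at this
  exact this.congr (wf_pow_ae α j).symm

lemma wf_pow_integral {α : ℝ} (hα : -1 < α) (j : ℕ) :
    ∫ x, x ^ j * wf α x = Real.Gamma (j + α + 1) := by
  rw [integral_congr_ae (wf_pow_ae α j), integral_indicator measurableSet_Ioi,
    Real.Gamma_eq_integral (by have : (0:ℝ) ≤ j := j.cast_nonneg; linarith)]

lemma wf_one_add_int {α : ℝ} (hα : -1 < α) (P : ℕ) :
    Integrable (fun x => (1 + |x|) ^ P * wf α x) := by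
  have : (fun x => (1 + |x|) ^ P * wf α x) = fun x =>
      ∑ j ∈ range (P + 1), (P.choose j : ℝ) * (x ^ j * wf α x) := by
    funext x
    by_cases hx : 0 ≤ x
    · rw [abs_of_nonneg hx, add_comm, add_pow, Finset.sum_mul]
      refine Finset.sum_congr rfl fun j _ => ?_
      simp; ring
    · simp [wf, hx]
  rw [this]
  exact integrable_finsetSum _ fun j _ => (wf_pow_int hα j).const_mul _

lemma poly_integrable {α : ℝ} (hα : -1 < α) {m : ℕ} (G : (Fin m → ℝ) → ℝ) (hG : Continuous G)
    (C : ℝ) (P : ℕ) (hb : ∀ y, |G y| ≤ C * ∏ k, (1 + |y k|) ^ P) :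
    Integrable (fun y => G y * ∏ k, wf α (y k)) := by
  have h1 : Integrable (fun y : Fin m → ℝ => ∏ k, ((1 + |y k|) ^ P * wf α (y k))) :=
    Integrable.fintype_prod (f := fun _ x => (1 + |x|) ^ P * wf α x)
      (fun _ => wf_one_add_int hα P)
  refine (h1.const_mul C).mono' ?_ (Eventually.of_forall fun y => ?_)
  · refine (hG.measurable.mul ?_).aestronglyMeasurable
    exact Finset.measurable_prod _ fun k _ => (wf_meas α).comp (measurable_pi_apply k)
  · have h2 : 0 ≤ ∏ k, wf α (y k) := Finset.prod_nonneg fun k _ => wf_nonneg _ _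
    rw [Real.norm_eq_abs, abs_mul, abs_of_nonneg h2, Finset.prod_mul_distrib, ← mul_assoc]
    exact mul_le_mul_of_nonneg_right (hb y) h2

lemma kN_cont (α : ℝ) (N : ℕ) : Continuous (fun p : ℝ × ℝ => kN α N p.1 p.2) := by
  unfold kN; fun_prop

lemma kN_bound (α : ℝ) (N : ℕ) : ∃ C : ℝ, 0 ≤ C ∧
    ∀ x y, |kN α N x y| ≤ C * ((1 + |x|) ^ N * (1 + |y|) ^ N) := by
  refine ⟨∑ a : Fin N, ∑ b : Fin N, |Bmat α N a b|, by positivity, fun x y => ?_⟩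
  unfold kN
  rw [Finset.sum_mul]
  refine (Finset.abs_sum_le_sum_abs _ _).trans (Finset.sum_le_sum fun a _ => ?_)
  rw [Finset.sum_mul]
  refine (Finset.abs_sum_le_sum_abs _ _).trans (Finset.sum_le_sum fun b _ => ?_)
  have h : ∀ (x : ℝ) (a : Fin N), |x| ^ (a:ℕ) ≤ (1 + |x|) ^ N := fun x a =>
    (pow_le_pow_left₀ (abs_nonneg x) (by linarith) _).trans
      (pow_le_pow_right₀ (by linarith [abs_nonneg x]) a.2.le)
  rw [abs_mul, abs_mul, abs_pow, abs_pow]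
  calc |x| ^ (a:ℕ) * |Bmat α N a b| * |y| ^ (b:ℕ)
      = |Bmat α N a b| * (|x| ^ (a:ℕ) * |y| ^ (b:ℕ)) := by ring
    _ ≤ _ := by gcongr <;> apply h

lemma kdet_cont (α : ℝ) (N m : ℕ) : Continuous (fun x : Fin m → ℝ => kdet α N x) := by
  unfold kdet
  refine Continuous.matrix_det ?_
  refine continuous_matrix fun i j => ?_
  exact Continuous.comp (g := fun p : ℝ × ℝ => kN α N p.1 p.2) (f := fun x : Fin m → ℝ => (x i, x j))
    (kN_cont α N) ((continuous_apply i).prodMk (continuous_apply j))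

lemma kdet_bound (α : ℝ) (N m : ℕ) : ∃ C : ℝ, 0 ≤ C ∧
    ∀ x : Fin m → ℝ, |kdet α N x| ≤ C * ∏ k, (1 + |x k|) ^ (2 * N) := by
  obtain ⟨C, hC, h⟩ := kN_bound α N
  refine ⟨∑ σ : Equiv.Perm (Fin m), C ^ m, by positivity, fun x => ?_⟩
  unfold kdet
  rw [Matrix.det_apply', Finset.sum_mul]
  refine (Finset.abs_sum_le_sum_abs _ _).trans (Finset.sum_le_sum fun σ _ => ?_)
  have hs : |((Equiv.Perm.sign σ : ℤ) : ℝ)| = 1 := by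
    rcases Int.units_eq_one_or (Equiv.Perm.sign σ) with h | h <;> simp [h]
  rw [abs_mul, hs, one_mul, Finset.abs_prod]
  calc ∏ i, |(Matrix.of fun i j : Fin m => kN α N (x i) (x j)) (σ i) i|
      ≤ ∏ i, (C * ((1 + |x (σ i)|) ^ N * (1 + |x i|) ^ N)) :=
        Finset.prod_le_prod (fun _ _ => abs_nonneg _) (fun i _ => h _ _)
    _ = C ^ m * ((∏ i, (1 + |x (σ i)|) ^ N) * ∏ i, (1 + |x i|) ^ N) := by
        rw [Finset.prod_mul_distrib, Finset.prod_mul_distrib]; simp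
    _ = _ := by
        rw [Equiv.prod_comp σ (fun i => (1 + |x i|) ^ N), ← Finset.prod_mul_distrib]
        congr 1
        refine Finset.prod_congr rfl fun i _ => ?_
        rw [← pow_add]; congr 1; ring

lemma append_cont {n m : ℕ} (t : Fin n → ℝ) :
    Continuous (fun y : Fin m → ℝ => (Fin.append t y : Fin (n + m) → ℝ)) := by
  refine continuous_pi fun i => ?_
  refine Fin.addCases (fun i => ?_) (fun i => ?_) i
  · simp only [Fin.append_left]; fun_prop
  · simp only [Fin.append_right]; fun_prop

lemma kdet_integrable {α : ℝ} (hα : -1 < α) (N : ℕ) {n m : ℕ} (t : Fin n → ℝ) :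
    Integrable (fun y : Fin m → ℝ => kdet α N (Fin.append t y) * ∏ k, wf α (y k)) := by
  obtain ⟨C, hC, h⟩ := kdet_bound α N (n + m)
  refine poly_integrable hα _ ((kdet_cont α N _).comp (append_cont t))
    (C * ∏ i, (1 + |t i|) ^ (2 * N)) (2 * N) fun y => (h _).trans (le_of_eq ?_)
  rw [Fin.prod_univ_add]
  simp [mul_assoc]

lemma bordered {m : ℕ} (A : Matrix (Fin m) (Fin m) ℝ) (b : Matrix (Fin m) (Fin 1) ℝ)
    (c : Matrix (Fin 1) (Fin m) ℝ) (d : Matrix (Fin 1) (Fin 1) ℝ) :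
    (Matrix.fromBlocks A b c d).det = d 0 0 * A.det - (c * A.adjugate * b) 0 0 := by
  have hinv : ∀ A : Matrix (Fin m) (Fin m) ℝ, A.det ≠ 0 →
      (Matrix.fromBlocks A b c d).det = d 0 0 * A.det - (c * A.adjugate * b) 0 0 := by
    intro A hA
    have : Invertible A := A.invertibleOfIsUnitDet (isUnit_iff_ne_zero.mpr hA)
    rw [Matrix.det_fromBlocks₁₁, Matrix.det_fin_one, Matrix.invOf_eq_nonsing_inv, Matrix.inv_def,
      Ring.inverse_eq_inv']
    simp only [Matrix.sub_apply, Matrix.mul_smul, Matrix.smul_mul, Matrix.smul_apply, smul_eq_mul]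
    field_simp
  have hcont : Continuous (fun ε : ℝ => A + ε • (1 : Matrix (Fin m) (Fin m) ℝ)) := by fun_prop
  have h1 : Continuous (fun ε : ℝ => (Matrix.fromBlocks (A + ε • (1 : Matrix (Fin m) (Fin m) ℝ))
      b c d).det) :=
    (hcont.matrix_fromBlocks continuous_const continuous_const continuous_const).matrix_det
  have h2 : Continuous (fun ε : ℝ => d 0 0 * (A + ε • (1 : Matrix (Fin m) (Fin m) ℝ)).det -
      (c * (A + ε • (1 : Matrix (Fin m) (Fin m) ℝ)).adjugate * b) 0 0) := by
    refine (continuous_const.mul hcont.matrix_det).sub ?_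
    have := (continuous_const (y := c)).matrix_mul hcont.matrix_adjugate
    exact (this.matrix_mul (continuous_const (y := b))).matrix_elem 0 0
  have hev : ∀ᶠ ε : ℝ in 𝓝[≠] 0, (A + ε • (1 : Matrix (Fin m) (Fin m) ℝ)).det ≠ 0 := by
    have hne : (-A).charpoly ≠ 0 := (Matrix.charpoly_monic _).ne_zero
    have hfin : {ε : ℝ | (-A).charpoly.IsRoot ε}.Finite := Polynomial.finite_setOfPred_isRoot hne
    have h3 : ∀ᶠ ε : ℝ in 𝓝[≠] 0, ε ∉ {ε : ℝ | (-A).charpoly.IsRoot ε} := by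
      have hf2 := hfin.subset (Set.sdiff_subset (t := {(0:ℝ)}))
      have h4 : ({ε : ℝ | (-A).charpoly.IsRoot ε} \ {0})ᶜ ∈ 𝓝 (0:ℝ) :=
        hf2.isClosed.isOpen_compl.mem_nhds (by simp)
      filter_upwards [mem_nhdsWithin_of_mem_nhds h4, self_mem_nhdsWithin] with ε h5 h6 h7
      exact h5 ⟨h7, h6⟩
    filter_upwards [h3] with ε hε h0
    apply hε
    simp only [Polynomial.IsRoot.def, Matrix.eval_charpoly]
    rw [← h0]
    congr 1
    rw [sub_neg_eq_add, add_comm]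
    congr 1
    ext i j
    simp [Matrix.one_apply, Matrix.diagonal_apply]
  have t1 := (h1.tendsto 0).mono_left (nhdsWithin_le_nhds (s := {0}ᶜ))
  have t2 := (h2.tendsto 0).mono_left (nhdsWithin_le_nhds (s := {0}ᶜ))
  have t3 := t1.congr' (hev.mono fun ε hε => hinv _ hε)
  have := tendsto_nhds_unique t3 t2
  simpa using this


lemma kdet_snoc (α : ℝ) (N : ℕ) {m : ℕ} (x : Fin m → ℝ) (z : ℝ) :
    kdet α N (Fin.snoc (α := fun _ => ℝ) x z) = kN α N z z * kdet α N x -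
      ∑ i, ∑ j, Matrix.adjugate (Matrix.of fun i j : Fin m => kN α N (x i) (x j)) j i *
        (kN α N z (x j) * kN α N (x i) z) := by
  have h : (Matrix.of fun i j : Fin (m + 1) => kN α N (Fin.snoc (α := fun _ => ℝ) x z i)
      (Fin.snoc (α := fun _ => ℝ) x z j)).submatrix finSumFinEquiv finSumFinEquiv =
      Matrix.fromBlocks (Matrix.of fun i j : Fin m => kN α N (x i) (x j))
        (Matrix.of fun i _ => kN α N (x i) z) (Matrix.of fun _ j => kN α N z (x j))
        (Matrix.of fun _ _ => kN α N z z) := by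
    have hl : ∀ i : Fin m, (Fin.snoc (α := fun _ => ℝ) x z : Fin (m+1) → ℝ) (Fin.castAdd 1 i) = x i :=
      fun i => Fin.snoc_castSucc (α := fun _ => ℝ) _ _ _
    have hr : ∀ i : Fin 1, (Fin.snoc (α := fun _ => ℝ) x z : Fin (m+1) → ℝ) (Fin.natAdd m i) = z :=
      fun i => by
        have : Fin.natAdd m i = Fin.last m := by ext; simp
        rw [this]; exact Fin.snoc_last (α := fun _ => ℝ) _ _
    ext (i | i) (j | j) <;> simp [hl, hr]
  unfold kdet
  rw [← Matrix.det_submatrix_equiv_self finSumFinEquiv, h, bordered]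
  congr 1
  simp only [Matrix.mul_apply, Matrix.of_apply, Finset.sum_mul]
  refine Finset.sum_congr rfl fun i _ => Finset.sum_congr rfl fun j _ => ?_
  ring

lemma polypoly_int {α : ℝ} (hα : -1 < α) {N : ℕ} (u v : Fin N → ℝ) :
    Integrable (fun z => (∑ b, u b * z ^ (b:ℕ)) * (∑ c, v c * z ^ (c:ℕ)) * wf α z) ∧
    ∫ z, (∑ b, u b * z ^ (b:ℕ)) * (∑ c, v c * z ^ (c:ℕ)) * wf α z =
      ∑ b, ∑ c, u b * v c * Gmat α N b c := by
  have e : (fun z => (∑ b, u b * z ^ (b:ℕ)) * (∑ c, v c * z ^ (c:ℕ)) * wf α z) =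
      fun z => ∑ b, ∑ c, u b * v c * (z ^ ((b:ℕ) + (c:ℕ)) * wf α z) := by
    funext z
    rw [Finset.sum_mul_sum, Finset.sum_mul]
    refine Finset.sum_congr rfl fun b _ => ?_
    rw [Finset.sum_mul]
    refine Finset.sum_congr rfl fun c _ => ?_
    ring
  have hi : ∀ b c : Fin N, Integrable fun z => u b * v c * (z ^ ((b:ℕ) + (c:ℕ)) * wf α z) :=
    fun b c => (wf_pow_int hα _).const_mul _
  rw [e]
  refine ⟨integrable_finsetSum _ fun b _ => integrable_finsetSum _ fun c _ => hi b c, ?_⟩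
  rw [integral_finsetSum _ fun b _ => integrable_finsetSum _ fun c _ => hi b c]
  refine Finset.sum_congr rfl fun b _ => ?_
  rw [integral_finsetSum _ fun c _ => hi b c]
  refine Finset.sum_congr rfl fun c _ => ?_
  rw [integral_const_mul, wf_pow_integral hα]
  simp [Gmat]

lemma kN_repro {α : ℝ} (hα : -1 < α) (N : ℕ) (x y : ℝ) :
    Integrable (fun z => kN α N z x * kN α N y z * wf α z) ∧
    ∫ z, kN α N z x * kN α N y z * wf α z = kN α N y x := by
  have h1 : ∀ z, kN α N z x = ∑ a : Fin N, (∑ b : Fin N, Bmat α N a b * x ^ (b:ℕ)) * z ^ (a:ℕ) :=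
    fun z => by
      unfold kN
      refine Finset.sum_congr rfl fun a _ => ?_
      rw [Finset.sum_mul]
      refine Finset.sum_congr rfl fun b _ => ?_
      ring
  have h2 : ∀ z, kN α N y z = ∑ b : Fin N, (∑ a : Fin N, y ^ (a:ℕ) * Bmat α N a b) * z ^ (b:ℕ) :=
    fun z => by
      unfold kN
      rw [Finset.sum_comm]
      refine Finset.sum_congr rfl fun a _ => ?_
      rw [Finset.sum_mul]
  simp only [h1, h2]
  obtain ⟨hi, he⟩ := polypoly_int hα (fun a : Fin N => ∑ b : Fin N, Bmat α N a b * x ^ (b:ℕ))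
    (fun b : Fin N => ∑ a : Fin N, y ^ (a:ℕ) * Bmat α N a b)
  refine ⟨hi, he.trans ?_⟩
  have hBG := BG hα N
  have hx : ∀ c : Fin N, ∑ b : Fin N, Gmat α N c b *
      (∑ d : Fin N, Bmat α N b d * x ^ (d:ℕ)) = x ^ (c:ℕ) := fun c => by
    have hGB : Gmat α N * Bmat α N = 1 := mul_eq_one_comm.mp hBG
    have := congrFun (congrArg (fun M => Matrix.mulVec M (fun d : Fin N => x ^ (d:ℕ))) hGB) c
    rw [← Matrix.mulVec_mulVec, Matrix.one_mulVec] at this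
    exact this
  rw [← h1 y, h2 x, Finset.sum_comm]
  refine Finset.sum_congr rfl fun c _ => ?_
  have hsym : ∀ b, Gmat α N b c = Gmat α N c b := fun b => by
    simp [Gmat, add_comm ((b : ℕ) : ℝ)]
  calc ∑ b, (∑ d : Fin N, Bmat α N b d * x ^ (d:ℕ)) * (∑ a : Fin N, y ^ (a:ℕ) * Bmat α N a c) * Gmat α N b c
      = (∑ a : Fin N, y ^ (a:ℕ) * Bmat α N a c) *
        ∑ b, Gmat α N c b * (∑ d : Fin N, Bmat α N b d * x ^ (d:ℕ)) := by
        rw [Finset.mul_sum]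
        refine Finset.sum_congr rfl fun b _ => ?_
        rw [hsym]; ring
    _ = _ := by
        rw [hx]

lemma kN_trace {α : ℝ} (hα : -1 < α) (N : ℕ) :
    Integrable (fun z => kN α N z z * wf α z) ∧ ∫ z, kN α N z z * wf α z = N := by
  have e : (fun z => kN α N z z * wf α z) =
      fun z => ∑ b : Fin N, ∑ c : Fin N, Bmat α N b c * (z ^ ((b:ℕ) + (c:ℕ)) * wf α z) := by
    funext z
    unfold kN
    rw [Finset.sum_mul]
    refine Finset.sum_congr rfl fun b _ => ?_
    rw [Finset.sum_mul]
    refine Finset.sum_congr rfl fun c _ => ?_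
    ring
  have hi : ∀ b c : Fin N, Integrable fun z => Bmat α N b c * (z ^ ((b:ℕ) + (c:ℕ)) * wf α z) :=
    fun b c => (wf_pow_int hα _).const_mul _
  rw [e]
  refine ⟨integrable_finsetSum _ fun b _ => integrable_finsetSum _ fun c _ => hi b c, ?_⟩
  rw [integral_finsetSum _ fun b _ => integrable_finsetSum _ fun c _ => hi b c]
  have : ((1 : Matrix (Fin N) (Fin N) ℝ)).trace = N := by simp
  rw [← this, ← BG hα N, Matrix.trace]
  refine Finset.sum_congr rfl fun b _ => ?_
  rw [integral_finsetSum _ fun c _ => hi b c, Matrix.diag_apply, Matrix.mul_apply]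
  refine Finset.sum_congr rfl fun c _ => ?_
  rw [integral_const_mul, wf_pow_integral hα]
  simp [Gmat, add_comm ((c : ℕ) : ℝ)]

lemma mehta_step {α : ℝ} (hα : -1 < α) (N : ℕ) {m : ℕ} (x : Fin m → ℝ) :
    ∫ z, kdet α N (Fin.snoc (α := fun _ => ℝ) x z) * wf α z = ((N:ℝ) - m) * kdet α N x := by
  set A : Matrix (Fin m) (Fin m) ℝ := Matrix.of fun i j : Fin m => kN α N (x i) (x j) with hA
  have e : (fun z => kdet α N (Fin.snoc (α := fun _ => ℝ) x z) * wf α z) = fun z =>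
      kdet α N x * (kN α N z z * wf α z) -
        ∑ i, ∑ j, A.adjugate j i * (kN α N z (x j) * kN α N (x i) z * wf α z) := by
    funext z
    rw [kdet_snoc, sub_mul, Finset.sum_mul]
    congr 1
    · ring
    · refine Finset.sum_congr rfl fun i _ => ?_
      rw [Finset.sum_mul]
      refine Finset.sum_congr rfl fun j _ => ?_
      rw [hA]; ring
  have hi : ∀ i j : Fin m, Integrable fun z =>
      A.adjugate j i * (kN α N z (x j) * kN α N (x i) z * wf α z) :=
    fun i j => (kN_repro hα N _ _).1.const_mul _
  rw [e, integral_sub ((kN_trace hα N).1.const_mul _)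
    (integrable_finsetSum _ fun b _ => integrable_finsetSum _ fun c _ => hi b c),
    integral_const_mul, (kN_trace hα N).2,
    integral_finsetSum _ fun b _ => integrable_finsetSum _ fun c _ => hi b c]
  have : ∑ i, ∫ z, ∑ j, A.adjugate j i * (kN α N z (x j) * kN α N (x i) z * wf α z) =
      m * kdet α N x := by
    have htr : (A * A.adjugate).trace = m * kdet α N x := by
      rw [Matrix.mul_adjugate, Matrix.trace_smul, Matrix.trace_one]
      simp [kdet, hA, mul_comm]
    rw [← htr, Matrix.trace]
    refine Finset.sum_congr rfl fun i _ => ?_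
    rw [integral_finsetSum _ fun c _ => hi i c, Matrix.diag_apply, Matrix.mul_apply]
    refine Finset.sum_congr rfl fun j _ => ?_
    rw [integral_const_mul, (kN_repro hα N _ _).2, mul_comm]
    simp [hA]
  rw [this]; ring

lemma integral_snoc {m : ℕ} (F : (Fin (m + 1) → ℝ) → ℝ) (hF : Integrable F) :
    ∫ y, F y = ∫ y : Fin m → ℝ, ∫ z : ℝ, F (Fin.snoc (α := fun _ => ℝ) y z) := by
  have mp := volume_preserving_piFinSuccAbove (fun _ : Fin (m + 1) => ℝ) (Fin.last m)
  have mp' := mp.symm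
  rw [← mp'.integral_comp (MeasurableEquiv.measurableEmbedding _)]
  have hi := (mp'.integrable_comp_emb (MeasurableEquiv.measurableEmbedding _)).mpr hF
  rw [Measure.volume_eq_prod] at hi ⊢
  refine (integral_prod_symm _ hi).trans ?_
  simp [MeasurableEquiv.piFinSuccAbove, Fin.insertNthEquiv, Fin.insertNth_last']

lemma mehta {α : ℝ} (hα : -1 < α) (N : ℕ) (m : ℕ) {n : ℕ} (t : Fin n → ℝ) :
    ∫ y : Fin m → ℝ, kdet α N (Fin.append t y) * ∏ k, wf α (y k) =
      (∏ i ∈ range m, ((N:ℝ) - (n + i : ℕ))) * kdet α N t := by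
  induction m with
  | zero =>
    rw [integral_unique]
    have h : ∀ y : Fin 0 → ℝ, kdet α N (Fin.append t y) = kdet α N t := fun y => by
      have : (Fin.append t y : Fin (n + 0) → ℝ) = t := by
        funext i
        exact Fin.append_left t _ i
      exact congrArg (kdet α N (m := n)) this
    rw [h]
    have hv : (volume : Measure (Fin 0 → ℝ)) Set.univ = 1 := by
      rw [volume_pi, Measure.pi_univ]; simp
    simp [measureReal_def, hv]
  | succ m ih =>
    rw [integral_snoc _ (kdet_integrable hα N t)]
    have : ∀ (y : Fin m → ℝ) (z : ℝ), kdet α N (Fin.append t (Fin.snoc (α := fun _ => ℝ) y z)) *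
        ∏ k : Fin (m+1), wf α (Fin.snoc (α := fun _ => ℝ) y z k) =
        (∏ k, wf α (y k)) *
        (kdet α N (Fin.snoc (α := fun _ => ℝ) (Fin.append t y) z) * wf α z) := fun y z => by
      rw [Fin.append_snoc, Fin.prod_univ_castSucc]
      simp only [Fin.snoc_castSucc, Fin.snoc_last]
      ring
    simp only [this, integral_const_mul, mehta_step hα]
    rw [Finset.prod_range_succ, mul_right_comm, ← ih, ← integral_mul_const]
    refine integral_congr_ae (Eventually.of_forall fun y => ?_)
    simp only []
    ring


lemma Bdet {α : ℝ} (hα : -1 < α) (N : ℕ) : (Bmat α N).det ≠ 0 := by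
  intro h
  have := congrArg Matrix.det (BG hα N)
  rw [Matrix.det_mul, h] at this
  simp at this

lemma vdm2_eq {N : ℕ} (x : Fin N → ℝ) : vdm2 x = (Matrix.vandermonde x).det ^ 2 := by
  unfold vdm2
  rw [Matrix.det_vandermonde, ← Finset.prod_pow]
  simp_rw [← Finset.prod_pow]
  rw [Finset.prod_filter, Fintype.prod_prod_type]
  refine Finset.prod_congr rfl fun i _ => ?_
  rw [← Finset.prod_filter]
  refine Finset.prod_congr ?_ fun _ _ => rfl
  ext j; simp

lemma kdet_vdm2 (α : ℝ) {N : ℕ} (x : Fin N → ℝ) : kdet α N x = (Bmat α N).det * vdm2 x := by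
  rw [vdm2_eq]
  have : (Matrix.of fun i j : Fin N => kN α N (x i) (x j)) =
      Matrix.vandermonde x * Bmat α N * (Matrix.vandermonde x).transpose := by
    ext i j
    simp only [Matrix.of_apply, kN, Matrix.mul_apply, Matrix.vandermonde_apply,
      Matrix.transpose_apply, Finset.sum_mul]
    rw [Finset.sum_comm]
  rw [kdet, this, Matrix.det_mul, Matrix.det_mul, Matrix.det_transpose]; ring

lemma card_lt (N : ℕ) :
    2 * (Finset.univ.filter (fun p : Fin N × Fin N => p.1 < p.2)).card = N * (N - 1) := by
  have h1 : (Finset.univ.filter (fun p : Fin N × Fin N => p.1 < p.2)).card =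
      (Finset.univ.filter (fun p : Fin N × Fin N => p.2 < p.1)).card := by
    refine Finset.card_bij (fun p _ => (p.2, p.1)) (by simp) ?_ ?_
    · rintro ⟨a, b⟩ _ ⟨c, d⟩ _ h; simp at h; simp [h]
    · rintro ⟨a, b⟩ h; exact ⟨(b, a), by simpa using h, rfl⟩
  have h2 : Finset.univ.filter (fun p : Fin N × Fin N => p.1 ≠ p.2) =
      (Finset.univ.filter (fun p : Fin N × Fin N => p.1 < p.2)) ∪
      (Finset.univ.filter (fun p : Fin N × Fin N => p.2 < p.1)) := by
    ext p; simp [lt_or_lt_iff_ne]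
  have h3 : Disjoint (Finset.univ.filter (fun p : Fin N × Fin N => p.1 < p.2))
      (Finset.univ.filter (fun p : Fin N × Fin N => p.2 < p.1)) := by
    rw [Finset.disjoint_left]; intro p; simp; intro h; exact h.le
  have h4 := Finset.offDiag_card (Finset.univ : Finset (Fin N))
  have h5 : (Finset.univ : Finset (Fin N)).offDiag =
     Finset.univ.filter (fun p : Fin N × Fin N => p.1 ≠ p.2) := by ext p; simp
  rw [h5, h2, Finset.card_union_of_disjoint h3, ← h1] at h4
  simp at h4
  rw [two_mul, h4, Nat.mul_sub, mul_one]

lemma vdm2_smul {N : ℕ} (c : ℝ) (x : Fin N → ℝ) : vdm2 (c • x) = c ^ (N * (N - 1)) * vdm2 x := by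
  unfold vdm2
  rw [← card_lt, pow_mul, ← Finset.prod_const, ← Finset.prod_mul_distrib]
  refine Finset.prod_congr rfl fun p _ => ?_
  simp; ring

/-- polynomial in `s` giving `vdm2 (u + s v)` -/
def vdp {N : ℕ} (u v : Fin N → ℝ) : Polynomial ℝ :=
  ∏ p ∈ Finset.univ.filter (fun p : Fin N × Fin N => p.1 < p.2),
    (Polynomial.C (u p.2 - u p.1) + Polynomial.C (v p.2 - v p.1) * Polynomial.X) ^ 2

lemma vdp_eval {N : ℕ} (u v : Fin N → ℝ) (s : ℝ) : (vdp u v).eval s = vdm2 (u + s • v) := by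
  unfold vdp vdm2
  rw [Polynomial.eval_prod]
  refine Finset.prod_congr rfl fun p _ => ?_
  simp; ring

lemma vdp_deg {N : ℕ} (u v : Fin N → ℝ) : (vdp u v).natDegree ≤ N * (N - 1) := by
  unfold vdp
  refine (Polynomial.natDegree_prod_le _ _).trans ?_
  rw [← card_lt, mul_comm]
  refine (Finset.sum_le_card_nsmul _ _ 2 fun p _ => ?_)
  refine Polynomial.natDegree_pow_le.trans ?_
  have : (Polynomial.C (u p.2 - u p.1) + Polynomial.C (v p.2 - v p.1) * Polynomial.X).natDegree ≤ 1 := by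
    compute_degree
  omega

lemma lagr (L : ℕ) (p : Polynomial ℝ) (hp : p.natDegree ≤ L) (s : ℝ) :
    p.eval s = ∑ i ∈ range (L + 1), p.eval (i:ℝ) * (Lagrange.basis (range (L+1)) (fun i : ℕ => (i:ℝ)) i).eval s := by
  have h := Lagrange.eq_interpolate (s := range (L+1)) (v := fun i : ℕ => (i:ℝ)) (f := p)
    (fun a _ b _ h => by simpa using h) (by
      rw [Finset.card_range]
      exact (Polynomial.degree_le_natDegree).trans_lt (by exact_mod_cast Nat.lt_succ_of_le hp))
  conv_lhs => rw [h]
  rw [Lagrange.interpolate_apply, Polynomial.eval_finsetSum]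
  simp

lemma append_lin {n m : ℕ} (t : Fin n → ℝ) (y : Fin m → ℝ) (s : ℝ) :
    (Fin.append (s • t) y : Fin (n+m) → ℝ) =
      Fin.append 0 y + s • Fin.append t 0 := by
  funext i
  refine Fin.addCases (fun i => ?_) (fun i => ?_) i <;> simp

lemma append_smul {n m : ℕ} (t : Fin n → ℝ) (y : Fin m → ℝ) (s : ℝ) :
    (s • Fin.append t y : Fin (n+m) → ℝ) = Fin.append (s • t) (s • y) := by
  funext i
  refine Fin.addCases (fun i => ?_) (fun i => ?_) i <;> simp

/-- simplex weight -/
def sx (α : ℝ) {m : ℕ} (ρ : ℝ) (y : Fin m → ℝ) : ℝ :=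
  if (∀ k, 0 ≤ y k) ∧ ∑ k, y k ≤ ρ then ∏ k, y k ^ α else 0

lemma sx_nonneg (α : ℝ) {m : ℕ} (ρ : ℝ) (y : Fin m → ℝ) : 0 ≤ sx α ρ y := by
  unfold sx; split_ifs with h
  · exact Finset.prod_nonneg fun k _ => Real.rpow_nonneg (h.1 k) _
  · rfl

lemma sx_meas (α : ℝ) {m : ℕ} : Measurable (fun p : (Fin m → ℝ) × ℝ => sx α p.2 p.1) := by
  unfold sx
  refine Measurable.ite ?_ ?_ measurable_const
  · have h1 : MeasurableSet {p : (Fin m → ℝ) × ℝ | ∀ k, 0 ≤ p.1 k} := by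
      have : {p : (Fin m → ℝ) × ℝ | ∀ k, 0 ≤ p.1 k} = ⋂ k, {p : (Fin m → ℝ) × ℝ | 0 ≤ p.1 k} := by
        ext; simp
      rw [this]
      exact MeasurableSet.iInter fun k => measurableSet_le measurable_const (by fun_prop)
    have h2 : MeasurableSet {p : (Fin m → ℝ) × ℝ | ∑ k, p.1 k ≤ p.2} :=
      measurableSet_le (by fun_prop) (by fun_prop)
    exact h1.inter h2
  · fun_prop

lemma wf_prod (α : ℝ) {m : ℕ} (y : Fin m → ℝ) : ∏ k, wf α (y k) =
    if ∀ k, 0 ≤ y k then (∏ k, y k ^ α) * Real.exp (-∑ k, y k) else 0 := by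
  split_ifs with h
  · rw [← Finset.sum_neg_distrib, Real.exp_sum, ← Finset.prod_mul_distrib]
    exact Finset.prod_congr rfl fun k _ => by simp [wf, h k]
  · push Not at h
    obtain ⟨k, hk⟩ := h
    exact Finset.prod_eq_zero (Finset.mem_univ k) (by simp [wf, not_le.mpr hk])

lemma sx_le (α : ℝ) {m : ℕ} (ρ : ℝ) (y : Fin m → ℝ) :
    sx α ρ y ≤ Real.exp ρ * ∏ k, wf α (y k) := by
  rw [wf_prod]
  unfold sx
  split_ifs with h1 h2 h2
  · have : 0 ≤ ∏ k, y k ^ α := Finset.prod_nonneg fun k _ => Real.rpow_nonneg (h2 k) _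
    rw [mul_left_comm, ← Real.exp_add]
    exact le_mul_of_one_le_right this (Real.one_le_exp (by linarith [h1.2]))
  · exact absurd h1.1 h2
  · have : 0 ≤ ∏ k, y k ^ α := Finset.prod_nonneg fun k _ => Real.rpow_nonneg (h2 k) _
    positivity
  · simp

lemma kdet_sx_int {α : ℝ} (hα : -1 < α) (N : ℕ) {n m : ℕ} (t : Fin n → ℝ) (ρ : ℝ) :
    Integrable (fun y : Fin m → ℝ => kdet α N (Fin.append t y) * sx α ρ y) := by
  refine ((kdet_integrable hα N (m := m) t).norm.const_mul (Real.exp ρ)).mono' ?_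
    (Eventually.of_forall fun y => ?_)
  · refine Measurable.aestronglyMeasurable ?_
    refine ((kdet_cont α N (n+m)).comp (append_cont t)).measurable.mul ?_
    exact (sx_meas α).comp (measurable_id.prodMk measurable_const)
  · have h2 : 0 ≤ ∏ k, wf α (y k) := Finset.prod_nonneg fun k _ => wf_nonneg _ _
    rw [norm_mul, norm_mul, Real.norm_of_nonneg (sx_nonneg _ _ _), Real.norm_of_nonneg h2,
      mul_left_comm]
    exact mul_le_mul_of_nonneg_left (sx_le _ _ _) (norm_nonneg _)

/-- simplex integral -/
def hh (α : ℝ) {n : ℕ} (m : ℕ) (t : Fin n → ℝ) (ρ : ℝ) : ℝ :=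
  ∫ y : Fin m → ℝ, kdet α (n+m) (Fin.append t y) * sx α ρ y

lemma sx_smul {α : ℝ} {m : ℕ} {ρ : ℝ} (hρ : 0 < ρ) (y : Fin m → ℝ) :
    sx α ρ (ρ • y) = ρ ^ (m * α) * sx α 1 y := by
  unfold sx
  have h1 : (∀ k, 0 ≤ (ρ • y) k) ↔ ∀ k, 0 ≤ y k := by simp [hρ]
  have h2 : ∑ k, (ρ • y) k ≤ ρ ↔ ∑ k, y k ≤ 1 := by
    simp only [Pi.smul_apply, smul_eq_mul, ← Finset.mul_sum]
    constructor
    · intro h; exact le_of_mul_le_mul_left (by simpa using h) hρ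
    · intro h; exact (mul_le_mul_of_nonneg_left h hρ.le).trans (by simp)
  simp only [h1, h2]
  split_ifs with h
  · simp only [Pi.smul_apply, smul_eq_mul]
    rw [Finset.prod_congr rfl fun k _ => Real.mul_rpow hρ.le (h.1 k), Finset.prod_mul_distrib]
    simp [mul_comm (m:ℝ), Real.rpow_mul hρ.le]
  · simp

lemma hh_scale {α : ℝ} {n m : ℕ} (t : Fin n → ℝ) {ρ : ℝ} (hρ : 0 < ρ) :
    hh α m t ρ = ρ ^ (((n+m)*(n+m-1) : ℕ) + (m:ℝ) * (1+α)) * hh α m (ρ⁻¹ • t) 1 := by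
  unfold hh
  have := Measure.integral_comp_smul (volume : Measure (Fin m → ℝ))
    (fun y => kdet α (n+m) (Fin.append t y) * sx α ρ y) ρ
  simp only [Module.finrank_fintype_fun_eq_card, Fintype.card_fin, smul_eq_mul] at this
  have h2 : ∀ y : Fin m → ℝ, kdet α (n+m) (Fin.append t (ρ • y)) * sx α ρ (ρ • y) =
     (ρ ^ ((n+m)*(n+m-1)) * ρ ^ ((m:ℝ)*α)) * (kdet α (n+m) (Fin.append (ρ⁻¹ • t) y) * sx α 1 y) := by
    intro y
    rw [sx_smul hρ, kdet_vdm2, kdet_vdm2]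
    have : (Fin.append t (ρ • y) : Fin (n+m) → ℝ) = ρ • Fin.append (ρ⁻¹ • t) y := by
      rw [append_smul, smul_smul, mul_inv_cancel₀ hρ.ne', one_smul]
    rw [this, vdm2_smul]; ring
  simp only [h2, integral_const_mul] at this
  have h3 : |(ρ ^ m)⁻¹| = (ρ^m)⁻¹ := abs_of_pos (by positivity)
  rw [h3] at this
  rw [Real.rpow_add hρ, Real.rpow_natCast, mul_add, mul_one, Real.rpow_add hρ, Real.rpow_natCast]
  have h4 : ρ ^ m ≠ 0 := by positivity
  rw [eq_comm, inv_mul_eq_iff_eq_mul₀ h4] at this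
  rw [this]; ring

/-- `hh` as polynomial in the scale -/
def Hp (α : ℝ) {n : ℕ} (m : ℕ) (t : Fin n → ℝ) : Polynomial ℝ :=
  ∑ i ∈ range ((n+m)*(n+m-1) + 1), Polynomial.C (hh α m ((i:ℝ) • t) 1) *
    Lagrange.basis (range ((n+m)*(n+m-1)+1)) (fun i : ℕ => (i:ℝ)) i

lemma Hp_eval {α : ℝ} (hα : -1 < α) {n : ℕ} (m : ℕ) (t : Fin n → ℝ) (s : ℝ) :
    (Hp α m t).eval s = hh α m (s • t) 1 := by
  unfold Hp hh
  rw [Polynomial.eval_finsetSum]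
  simp only [Polynomial.eval_mul, Polynomial.eval_C]
  simp_rw [← integral_mul_const]
  rw [← integral_finsetSum _ fun i _ => (kdet_sx_int hα (n+m) _ 1).mul_const _]
  refine integral_congr_ae (Eventually.of_forall fun y => ?_)
  simp only []
  have := lagr _ _ (vdp_deg (Fin.append (0 : Fin n → ℝ) y) (Fin.append t (0 : Fin m → ℝ))) s
  simp only [vdp_eval, ← append_lin] at this
  rw [kdet_vdm2, this, Finset.mul_sum, Finset.sum_mul]
  refine Finset.sum_congr rfl fun i _ => ?_
  rw [kdet_vdm2]; ring

lemma Hp_deg (α : ℝ) {n : ℕ} (m : ℕ) (t : Fin n → ℝ) :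
    (Hp α m t).natDegree ≤ (n+m)*(n+m-1) := by
  unfold Hp
  refine Polynomial.natDegree_sum_le_of_forall_le _ _ fun i hi => ?_
  refine (Polynomial.natDegree_C_mul_le _ _).trans ?_
  refine Polynomial.natDegree_le_of_degree_le ?_
  rw [Lagrange.degree_basis (fun a _ b _ h => by simpa using h) hi]
  simp


lemma sx_int_rho {α : ℝ} {m : ℕ} (y : Fin m → ℝ) :
    Integrable (fun ρ : ℝ => sx α ρ y * Real.exp (-ρ)) ∧
    ∫ ρ : ℝ, sx α ρ y * Real.exp (-ρ) = ∏ k, wf α (y k) := by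
  rw [wf_prod]
  by_cases h : ∀ k, 0 ≤ y k
  · have : (fun ρ : ℝ => sx α ρ y * Real.exp (-ρ)) =
        (Set.Ici (∑ k, y k)).indicator (fun ρ => (∏ k, y k ^ α) * Real.exp (-ρ)) := by
      funext ρ
      by_cases h2 : ∑ k, y k ≤ ρ
      · rw [Set.indicator_of_mem (by simpa using h2)]
        simp only [sx, h, h2, implies_true, and_self, if_true]
      · rw [Set.indicator_of_notMem (by simpa using h2)]
        simp only [sx, h2, and_false, if_false, zero_mul]
    rw [this, if_pos h, integral_indicator measurableSet_Ici,
      integrable_indicator_iff measurableSet_Ici]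
    constructor
    · refine Integrable.const_mul ?_ _
      have := integrableOn_Ici_iff_integrableOn_Ioi (f := fun ρ : ℝ => Real.exp (-ρ)) (μ := volume) (b := ∑ k, y k)
      rw [← IntegrableOn, this]
      simpa using exp_neg_integrableOn_Ioi (∑ k, y k) one_pos
    · rw [integral_const_mul, integral_Ici_eq_integral_Ioi, integral_exp_neg_Ioi]
  · have : (fun ρ : ℝ => sx α ρ y * Real.exp (-ρ)) = fun _ => 0 := by
      funext ρ
      simp only [sx, h, false_and, if_false, zero_mul]
    rw [this, if_neg h]
    exact ⟨integrable_zero _ _ _, by simp⟩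

lemma hh_neg {α : ℝ} {n m : ℕ} (t : Fin n → ℝ) {ρ : ℝ} (hρ : ρ < 0) : hh α m t ρ = 0 := by
  unfold hh
  have : ∀ y : Fin m → ℝ, sx α ρ y = 0 := fun y => by
    unfold sx
    rw [if_neg]
    rintro ⟨h1, h2⟩
    have : 0 ≤ ∑ k, y k := Finset.sum_nonneg fun k _ => h1 k
    linarith
  simp [this]

lemma laplace {α : ℝ} (hα : -1 < α) {n m : ℕ} (t : Fin n → ℝ) :
    ∫ y : Fin m → ℝ, kdet α (n+m) (Fin.append t y) * ∏ k, wf α (y k) =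
      ∫ ρ in Set.Ioi (0:ℝ), Real.exp (-ρ) * hh α m t ρ := by
  have hF : Integrable (fun p : (Fin m → ℝ) × ℝ =>
      kdet α (n+m) (Fin.append t p.1) * (sx α p.2 p.1 * Real.exp (-p.2))) (volume.prod volume) := by
    rw [integrable_prod_iff]
    · refine ⟨Eventually.of_forall fun y => ((sx_int_rho (α := α) y).1.const_mul (kdet α (n+m) (Fin.append t y))), ?_⟩
      refine (kdet_integrable hα (n+m) (m := m) t).norm.congr (Eventually.of_forall fun y => ?_)
      have h2 : 0 ≤ ∏ k, wf α (y k) := Finset.prod_nonneg fun k _ => wf_nonneg _ _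
      simp only [norm_mul]
      rw [integral_const_mul, Real.norm_of_nonneg h2, ← (sx_int_rho y).2]
      congr 1
      refine integral_congr_ae (Eventually.of_forall fun ρ => ?_)
      simp only []
      rw [Real.norm_of_nonneg (sx_nonneg _ _ _), Real.norm_of_nonneg (Real.exp_pos _).le]
    · refine Measurable.aestronglyMeasurable ?_
      refine (((kdet_cont α (n+m) (n+m)).comp (append_cont t)).measurable.comp measurable_fst).mul ?_
      exact (sx_meas α).mul (by fun_prop)
  have := integral_integral_swap (f := fun (y : Fin m → ℝ) (ρ : ℝ) => kdet α (n+m) (Fin.append t y) * (sx α ρ y * Real.exp (-ρ))) hF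
  simp only [integral_const_mul, (sx_int_rho _).2] at this
  rw [this]
  rw [← integral_indicator measurableSet_Ioi]
  have h0 : ∀ᵐ x : ℝ, x ≠ 0 := by
    rw [ae_iff]; simp
  refine integral_congr_ae ?_
  filter_upwards [h0] with ρ hρ
  have h1 : ∫ y : Fin m → ℝ, kdet α (n+m) (Fin.append t y) * (sx α ρ y * Real.exp (-ρ)) =
      Real.exp (-ρ) * hh α m t ρ := by
    unfold hh
    rw [← integral_const_mul]
    refine integral_congr_ae (Eventually.of_forall fun y => ?_)
    simp only []; ring
  rw [h1]
  rcases lt_or_gt_of_ne hρ with h | h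
  · rw [Set.indicator_of_notMem (by simpa using h.le), hh_neg t h, mul_zero]
  · rw [Set.indicator_of_mem (by simpa using h)]

/-- exponent -/
def M0 (α : ℝ) (n m : ℕ) : ℝ := ((n+m)*(n+m-1) : ℕ) + (m:ℝ) * (1+α)

lemma hh_poly {α : ℝ} (hα : -1 < α) {n m : ℕ} (t : Fin n → ℝ) (s : ℝ) {ρ : ℝ} (hρ : 0 < ρ) :
    hh α m (s • t) ρ = ∑ d ∈ range ((n+m)*(n+m-1) + 1),
      (Hp α m t).coeff d * s ^ d * ρ ^ (M0 α n m - d) := by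
  rw [hh_scale _ hρ, smul_smul, ← Hp_eval hα,
    Polynomial.eval_eq_sum_range' (Nat.lt_succ_of_le (Hp_deg α m t)), Finset.mul_sum]
  refine Finset.sum_congr rfl fun d _ => ?_
  rw [← M0, Real.rpow_sub hρ, Real.rpow_natCast, mul_pow, inv_pow]
  field_simp

lemma M0_pos {α : ℝ} (hα : -1 < α) {n m d : ℕ} (hd : d ∈ range ((n+m)*(n+m-1)+1)) :
    0 < M0 α n m - d + 1 := by
  have h1 : (d:ℝ) ≤ ((n+m)*(n+m-1) : ℕ) := by
    exact_mod_cast Nat.lt_succ_iff.mp (Finset.mem_range.mp hd)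
  have : 0 ≤ (m:ℝ) * (1+α) := mul_nonneg m.cast_nonneg (by linarith)
  unfold M0; linarith

lemma laplace_poly {α : ℝ} (hα : -1 < α) {n m : ℕ} (t : Fin n → ℝ) (s : ℝ) :
    ∫ ρ in Set.Ioi (0:ℝ), Real.exp (-ρ) * hh α m (s • t) ρ =
    ∑ d ∈ range ((n+m)*(n+m-1) + 1), (Hp α m t).coeff d * Real.Gamma (M0 α n m - d + 1) * s ^ d := by
  have h1 : ∫ ρ in Set.Ioi (0:ℝ), Real.exp (-ρ) * hh α m (s • t) ρ =
      ∫ ρ in Set.Ioi (0:ℝ), ∑ d ∈ range ((n+m)*(n+m-1) + 1), ((Hp α m t).coeff d * s ^ d) *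
        (Real.exp (-ρ) * ρ ^ (M0 α n m - d + 1 - 1)) := by
    refine setIntegral_congr_fun measurableSet_Ioi fun ρ hρ => ?_
    rw [hh_poly hα t s hρ, Finset.mul_sum]
    refine Finset.sum_congr rfl fun d _ => ?_
    rw [add_sub_cancel_right]; ring
  rw [h1, integral_finsetSum _ fun d hd =>
    (Real.GammaIntegral_convergent (M0_pos hα hd)).const_mul _]
  refine Finset.sum_congr rfl fun d hd => ?_
  rw [integral_const_mul, ← Real.Gamma_eq_integral (M0_pos hα hd)]; ring

/-- polynomial in scale for kernel -/
def kNp (α : ℝ) (N : ℕ) (x y : ℝ) : Polynomial ℝ :=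
  ∑ a : Fin N, ∑ b : Fin N, Polynomial.C (x ^ (a:ℕ) * Bmat α N a b * y ^ (b:ℕ)) *
    Polynomial.X ^ ((a:ℕ)+(b:ℕ))

def ep (α : ℝ) (N : ℕ) {n : ℕ} (t : Fin n → ℝ) : Polynomial ℝ :=
  Matrix.det (Matrix.of fun i j : Fin n => kNp α N (t i) (t j))

lemma ep_eval (α : ℝ) (N : ℕ) {n : ℕ} (t : Fin n → ℝ) (s : ℝ) :
    (ep α N t).eval s = kdet α N (s • t) := by
  unfold ep kdet
  rw [← Polynomial.coe_evalRingHom, RingHom.map_det]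
  congr 1
  ext i j
  simp only [RingHom.mapMatrix_apply, Matrix.map_apply, Matrix.of_apply, kNp, kN,
    Polynomial.coe_evalRingHom, Polynomial.eval_finsetSum]
  refine Finset.sum_congr rfl fun a _ => Finset.sum_congr rfl fun b _ => ?_
  simp; ring

lemma Hp_coeff {α : ℝ} (hα : -1 < α) {n m : ℕ} (t : Fin n → ℝ) (d : ℕ) :
    (m.factorial : ℝ) * (ep α (n+m) t).coeff d =
      if d ∈ range ((n+m)*(n+m-1) + 1) then
        (Hp α m t).coeff d * Real.Gamma (M0 α n m - d + 1) else 0 := by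
  have key : Polynomial.C (m.factorial : ℝ) * ep α (n+m) t =
      ∑ d ∈ range ((n+m)*(n+m-1) + 1),
        Polynomial.C ((Hp α m t).coeff d * Real.Gamma (M0 α n m - d + 1)) * Polynomial.X ^ d := by
    refine Polynomial.funext fun s => ?_
    rw [Polynomial.eval_mul, ep_eval, Polynomial.eval_C, Polynomial.eval_finsetSum]
    simp only [Polynomial.eval_mul, Polynomial.eval_C, Polynomial.eval_pow, Polynomial.eval_X]
    rw [← laplace_poly hα, ← laplace hα, mehta hα]
    congr 1
    rw [← Finset.prod_range_add_one_eq_factorial, Nat.cast_prod, ← Finset.prod_range_reflect]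
    refine Finset.prod_congr rfl fun i hi => ?_
    have : i < m := Finset.mem_range.mp hi
    rw [show m - 1 - i + 1 = m - i by omega, Nat.cast_sub this.le]
    push_cast; ring
  have := congrArg (fun p => Polynomial.coeff p d) key
  simp only [Polynomial.coeff_C_mul, Polynomial.finsetSum_coeff, Polynomial.coeff_X_pow] at this
  rw [this]
  simp

lemma hh_final {α : ℝ} (hα : -1 < α) {n m : ℕ} (t : Fin n → ℝ) {ρ : ℝ} (hρ : 0 < ρ) :
    hh α m t ρ = m.factorial * ∑ d ∈ range ((n+m)*(n+m-1) + 1),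
      (ep α (n+m) t).coeff d * (ρ ^ (M0 α n m - d) / Real.Gamma (M0 α n m - d + 1)) := by
  have := hh_poly hα (m := m) t 1 hρ
  rw [one_smul] at this
  rw [this, Finset.mul_sum]
  refine Finset.sum_congr rfl fun d hd => ?_
  rw [← mul_assoc, Hp_coeff hα, if_pos hd]
  have := (Real.Gamma_pos_of_pos (M0_pos hα hd)).ne'
  rw [one_pow]
  field_simp

lemma ep_coeff_zero {α : ℝ} (hα : -1 < α) {n m : ℕ} (t : Fin n → ℝ) (d : ℕ)
    (hd : d ∉ range ((n+m)*(n+m-1) + 1)) : (ep α (n+m) t).coeff d = 0 := by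
  have := Hp_coeff hα (m := m) t d
  rw [if_neg hd] at this
  exact (mul_eq_zero.mp this).resolve_left (by exact_mod_cast m.factorial_ne_zero)


lemma M0_eq (α : ℝ) (n m : ℕ) : M0 α n m =
    ((n+m:ℕ):ℝ) * (((n+m:ℕ):ℝ) + α) - n * (1 + α) := by
  unfold M0
  rcases Nat.eq_zero_or_pos (n+m) with h | h
  · have h1 : n = 0 := by omega
    have h2 : m = 0 := by omega
    subst h1 h2; simp
  · rw [Nat.cast_mul, Nat.cast_sub h]; push_cast; ring

lemma append_zero_left {N : ℕ} (t : Fin 0 → ℝ) (y : Fin N → ℝ) :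
    (Fin.append t y : Fin (0+N) → ℝ) = y ∘ Fin.cast (Nat.zero_add N) := by
  funext i
  refine Fin.addCases (fun i => i.elim0) (fun i => ?_) i
  rw [Fin.append_right]
  simp

lemma vdm2_cast {K N : ℕ} (h : K = N) (y : Fin N → ℝ) : vdm2 (y ∘ Fin.cast h) = vdm2 y := by
  subst h; rfl

lemma btlueZ_eq {α : ℝ} (hα : -1 < α) (N : ℕ) {r : ℝ} (hr : 0 < r) :
    btlueZ α N r = (Bmat α N).det⁻¹ * N.factorial *
      (r ^ ((N:ℝ)*(N+α)) / Real.Gamma ((N:ℝ)*(N+α)+1)) := by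
  have h1 : btlueZ α N r = (Bmat α N).det⁻¹ * hh α N (fun i : Fin 0 => i.elim0) r := by
    unfold btlueZ hh
    rw [← integral_const_mul]
    refine integral_congr_ae (Eventually.of_forall fun y => ?_)
    simp only []
    rw [kdet_vdm2, append_zero_left, vdm2_cast (Nat.zero_add N)]
    have h2 : (Bmat α (0+N)).det = (Bmat α N).det := by congr 2 <;> simp
    rw [h2, mul_assoc, inv_mul_cancel_left₀ (Bdet hα N)]
    unfold sx lagWeight
    split_ifs <;> simp
  rw [h1, hh_final hα _ hr]
  rw [Finset.sum_eq_single 0]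
  · have : (ep α (0+N) (fun i : Fin 0 => (i.elim0 : ℝ))) = 1 := by
      unfold ep; simp
    rw [this, M0_eq]
    simp; ring
  · intro d _ hd
    have : (ep α (0+N) (fun i : Fin 0 => (i.elim0 : ℝ))) = 1 := by
      unfold ep; simp
    rw [this, Polynomial.coeff_one, if_neg hd, zero_mul]
  · simp

lemma fv_append {n m : ℕ} (t : Fin n → ℝ) (y : Fin m → ℝ) :
    (fun i : Fin (n+m) => if (i : ℕ) < n then extFun t (i : ℕ) else extFun y ((i : ℕ) - n)) =
      Fin.append t y := by
  funext i
  refine Fin.addCases (fun i => ?_) (fun i => ?_) i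
  · simp [extFun]
  · simp [extFun]

lemma lag_append (α : ℝ) {n m : ℕ} (t : Fin n → ℝ) (y : Fin m → ℝ) :
    lagWeight α (Fin.append t y) = (∏ i, t i ^ α) * ∏ k, y k ^ α := by
  unfold lagWeight
  rw [Fin.prod_univ_add]; simp

lemma full_int {α : ℝ} (hα : -1 < α) {n m : ℕ} (t : Fin n → ℝ) (r : ℝ) (k : ℕ) (hk : k = m) :
    ∫ y : Fin k → ℝ, (if (∀ j, 0 ≤ y j) ∧ (∑ i, t i) + (∑ j, y j) ≤ r then
      vdm2 (fun i : Fin (n+m) => if (i : ℕ) < n then extFun t (i : ℕ) else extFun y ((i : ℕ) - n)) *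
      lagWeight α (fun i : Fin (n+m) => if (i : ℕ) < n then extFun t (i : ℕ) else extFun y ((i : ℕ) - n))
      else 0) = (∏ i, t i ^ α) * (Bmat α (n+m)).det⁻¹ * hh α m t (r - ∑ i, t i) := by
  subst hk
  unfold hh
  rw [← integral_const_mul]
  refine integral_congr_ae (Eventually.of_forall fun y => ?_)
  simp only [fv_append]
  rw [kdet_vdm2, lag_append]
  have h : (∑ i, t i) + (∑ j, y j) ≤ r ↔ ∑ j, y j ≤ r - ∑ i, t i := by
    constructor <;> intro h <;> linarith
  simp only [h]
  have := Bdet hα (n+k)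
  unfold sx
  split_ifs
  · field_simp
  · simp

lemma btlueR_formula {α : ℝ} (hα : -1 < α) {n N : ℕ} (hn : n ≤ N) (t : Fin n → ℝ)
    (ht : ∀ i, 0 ≤ t i) {r : ℝ} (hr : 0 < r) (htr : ∑ i, t i < r) :
    btlueR α N n r t = (∏ i, t i ^ α) * ∑' d : ℕ, (ep α N t).coeff d *
      (Real.Gamma ((N:ℝ)*(N+α)+1) / Real.Gamma ((N:ℝ)*(N+α)-n*(1+α)-d+1) *
        ((r - ∑ i, t i) ^ ((N:ℝ)*(N+α)-n*(1+α)-d) / r ^ ((N:ℝ)*(N+α)))) := by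
  obtain ⟨m, rfl⟩ := Nat.exists_eq_add_of_le hn
  have hs : 0 < r - ∑ i, t i := by linarith
  rw [btlueR, if_pos ht]
  unfold fullVec
  rw [full_int hα t r _ (by omega), hh_final hα _ hs, btlueZ_eq hα _ hr, M0_eq,
    tsum_eq_sum (s := range ((n+m)*(n+m-1)+1)) (fun d hd => by
      rw [ep_coeff_zero hα t d hd, zero_mul])]
  have h1 := Bdet hα (n+m)
  have h2 : (((n+m).factorial : ℕ) : ℝ) ≠ 0 := by exact_mod_cast Nat.factorial_ne_zero _
  have h3 : ((m.factorial : ℕ) : ℝ) ≠ 0 := by exact_mod_cast Nat.factorial_ne_zero _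
  have h4 : (r ^ (((n+m:ℕ):ℝ)*(((n+m:ℕ):ℝ)+α))) ≠ 0 := by positivity
  have h5 : Real.Gamma (((n+m:ℕ):ℝ)*(((n+m:ℕ):ℝ)+α)+1) ≠ 0 := by
    refine (Real.Gamma_pos_of_pos ?_).ne'
    have := M0_pos hα (n := 0) (m := n+m) (d := 0) (by simp)
    rw [M0_eq] at this; simpa using this
  rw [show n + m - n = m by omega]
  rw [show ∀ a b c d e f g : ℝ, a / b / (c⁻¹ * a * d) * (e * c⁻¹ * (b * f)) =
    (a/a) * (b/b) * (c⁻¹/c⁻¹) * (e * (d⁻¹ * f)) from fun a b c d e f g => by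
      ring]
  rw [div_self h2, div_self h3, div_self (inv_ne_zero h1)]
  rw [Finset.mul_sum]
  simp only [one_mul]
  congr 1
  refine Finset.sum_congr rfl fun d _ => ?_
  rw [inv_div]; ring
  exact 0


/-- coefficient bound predicate -/
def Bd (B ρ : ℝ) (p : PowerSeries ℝ) : Prop := ∀ d, |PowerSeries.coeff d p| ≤ B * ρ ^ d

lemma Bd.mono {B ρ ρ' : ℝ} {p : PowerSeries ℝ} (h : Bd B ρ p) (hB : 0 ≤ B) (hρ : 0 ≤ ρ)
    (hρ' : ρ ≤ ρ') : Bd B ρ' p := fun d =>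
  (h d).trans (mul_le_mul_of_nonneg_left (pow_le_pow_left₀ hρ hρ' d) hB)

lemma Bd.mul {B B' ρ : ℝ} {p q : PowerSeries ℝ} (hp : Bd B ρ p) (hq : Bd B' ρ q)
    (hB : 0 ≤ B) (hB' : 0 ≤ B') (hρ : 0 ≤ ρ) : Bd (B * B') (2 * ρ) (p * q) := fun d => by
  rw [PowerSeries.coeff_mul]
  refine (Finset.abs_sum_le_sum_abs _ _).trans ?_
  have h1 : ∀ x ∈ antidiagonal d, |PowerSeries.coeff x.1 p * PowerSeries.coeff x.2 q| ≤
      B * B' * ρ ^ d := fun x hx => by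
    rw [abs_mul, ← Finset.HasAntidiagonal.mem_antidiagonal.mp hx, pow_add]
    calc _ ≤ (B * ρ ^ x.1) * (B' * ρ ^ x.2) :=
          mul_le_mul (hp _) (hq _) (abs_nonneg _) (by positivity)
      _ = _ := by ring
  refine (Finset.sum_le_card_nsmul _ _ _ h1).trans ?_
  rw [Finset.Nat.card_antidiagonal, nsmul_eq_mul, mul_pow]
  have h2 : ((d + 1 : ℕ) : ℝ) ≤ 2 ^ d := by exact_mod_cast Nat.lt_two_pow_self
  have h3 : 0 ≤ B * B' * ρ ^ d := by positivity
  calc _ ≤ 2 ^ d * (B * B' * ρ ^ d) := mul_le_mul_of_nonneg_right h2 h3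
    _ = _ := by ring

lemma Bd.prod {ι : Type*} (s : Finset ι) (p : ι → PowerSeries ℝ) {B ρ : ℝ} (hB : 0 ≤ B)
    (hρ : 0 ≤ ρ) (h : ∀ i ∈ s, Bd B ρ (p i)) :
    Bd (B ^ s.card) (2 ^ s.card * ρ) (∏ i ∈ s, p i) := by
  induction s using Finset.induction_on with
  | empty =>
    intro d
    rw [Finset.prod_empty, PowerSeries.coeff_one]
    split_ifs with h
    · subst h; simp
    · simp; positivity
  | insert i s hi ih =>
    rw [Finset.prod_insert hi, Finset.card_insert_of_notMem hi, pow_succ', pow_succ', mul_assoc]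
    refine Bd.mul ?_ (ih fun j hj => h j (Finset.mem_insert_of_mem hj)) hB (by positivity) (by positivity)
    refine (h i (Finset.mem_insert_self _ _)).mono hB hρ ?_
    exact le_mul_of_one_le_left hρ (one_le_pow₀ (by norm_num))

lemma Bd.det {n : ℕ} (A : Matrix (Fin n) (Fin n) (PowerSeries ℝ)) {B ρ : ℝ} (hB : 0 ≤ B)
    (hρ : 0 ≤ ρ) (h : ∀ i j, Bd B ρ (A i j)) :
    Bd (n.factorial * B ^ n) (2 ^ n * ρ) A.det := by
  intro d
  rw [Matrix.det_apply, map_sum]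
  refine (Finset.abs_sum_le_sum_abs _ _).trans ?_
  have h1 : ∀ σ ∈ (Finset.univ : Finset (Equiv.Perm (Fin n))),
      |PowerSeries.coeff d (Equiv.Perm.sign σ • ∏ i, A (σ i) i)| ≤ B ^ n * (2 ^ n * ρ) ^ d := by
    intro σ _
    have := Bd.prod Finset.univ (fun i => A (σ i) i) hB hρ (fun i _ => h _ _) d
    simp only [Finset.card_univ, Fintype.card_fin] at this
    rcases Int.units_eq_one_or (Equiv.Perm.sign σ) with h | h <;> simpa [h] using this
  refine (Finset.sum_le_card_nsmul _ _ _ h1).trans ?_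
  rw [Finset.card_univ, Fintype.card_perm, Fintype.card_fin, nsmul_eq_mul, mul_assoc]

open PowerSeries.WithPiTopology in
lemma det_coeff_tendsto {ι : Type*} {l : Filter ι} {n : ℕ}
    (A : ι → Matrix (Fin n) (Fin n) (PowerSeries ℝ)) (A' : Matrix (Fin n) (Fin n) (PowerSeries ℝ))
    (h : ∀ i j d, Tendsto (fun N => PowerSeries.coeff d (A N i j)) l (𝓝 (PowerSeries.coeff d (A' i j))))
    (d : ℕ) : Tendsto (fun N => PowerSeries.coeff d (A N).det) l (𝓝 (PowerSeries.coeff d A'.det)) := by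
  have h1 : Tendsto A l (𝓝 A') := by
    refine tendsto_pi_nhds.mpr fun i => tendsto_pi_nhds.mpr fun j => ?_
    rw [tendsto_iff_coeff_tendsto]
    exact h i j
  have h2 : Continuous (fun M : Matrix (Fin n) (Fin n) (PowerSeries ℝ) => M.det) :=
    Continuous.matrix_det continuous_id
  have h3 := (h2.tendsto A').comp h1
  rw [tendsto_iff_coeff_tendsto] at h3
  exact h3 d

/-- evaluation at one -/
def Ev (p : PowerSeries ℝ) (v : ℝ) : Prop :=
  Summable (fun d => ‖PowerSeries.coeff d p‖) ∧ ∑' d, PowerSeries.coeff d p = v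

lemma Ev.mul {p q : PowerSeries ℝ} {v w : ℝ} (hp : Ev p v) (hq : Ev q w) : Ev (p * q) (v * w) := by
  have e : ∀ d, PowerSeries.coeff d (p * q) = ∑ kl ∈ Finset.HasAntidiagonal.antidiagonal d,
      (fun i => PowerSeries.coeff i p) kl.1 * (fun i => PowerSeries.coeff i q) kl.2 :=
    fun d => PowerSeries.coeff_mul d p q
  have h1 := summable_norm_sum_mul_antidiagonal_of_summable_norm hp.1 hq.1
  have h2 := tsum_mul_tsum_eq_tsum_sum_antidiagonal_of_summable_norm hp.1 hq.1
  refine ⟨?_, ?_⟩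
  · refine h1.congr fun d => ?_
    rw [e d]
  · rw [← hp.2, ← hq.2, h2]
    exact tsum_congr e

lemma Ev.prod {ι : Type*} (s : Finset ι) (p : ι → PowerSeries ℝ) (v : ι → ℝ)
    (h : ∀ i ∈ s, Ev (p i) (v i)) : Ev (∏ i ∈ s, p i) (∏ i ∈ s, v i) := by
  induction s using Finset.induction_on with
  | empty =>
    simp only [Finset.prod_empty]
    have h0 : ∀ d, d ∉ ({0} : Finset ℕ) → PowerSeries.coeff d (1 : PowerSeries ℝ) = 0 := by
      intro d hd
      rw [PowerSeries.coeff_one, if_neg (by simpa using hd)]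
    refine ⟨summable_of_ne_finset_zero (s := {0}) fun d hd => by rw [h0 d hd, norm_zero], ?_⟩
    rw [tsum_eq_sum h0]; simp
  | insert i s hi ih =>
    rw [Finset.prod_insert hi, Finset.prod_insert hi]
    exact (h i (Finset.mem_insert_self _ _)).mul (ih fun j hj => h j (Finset.mem_insert_of_mem hj))

lemma Ev.sum {ι : Type*} (s : Finset ι) (p : ι → PowerSeries ℝ) (v : ι → ℝ)
    (h : ∀ i ∈ s, Ev (p i) (v i)) : Ev (∑ i ∈ s, p i) (∑ i ∈ s, v i) := by
  refine ⟨?_, ?_⟩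
  · simp only [map_sum]
    refine Summable.of_nonneg_of_le (fun _ => norm_nonneg _) (fun d => norm_sum_le _ _) ?_
    exact summable_sum fun i hi => (h i hi).1
  · simp only [map_sum]
    rw [Summable.tsum_finsetSum fun i hi => (h i hi).1.of_norm]
    exact Finset.sum_congr rfl fun i hi => (h i hi).2

lemma Ev.det {n : ℕ} (A : Matrix (Fin n) (Fin n) (PowerSeries ℝ)) (V : Matrix (Fin n) (Fin n) ℝ)
    (h : ∀ i j, Ev (A i j) (V i j)) : Ev A.det V.det := by
  rw [Matrix.det_apply, Matrix.det_apply]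
  refine Ev.sum _ _ _ fun σ _ => ?_
  have := Ev.prod Finset.univ (fun i => A (σ i) i) (fun i => V (σ i) i) (fun i _ => h _ _)
  rcases Int.units_eq_one_or (Equiv.Perm.sign σ) with h | h
  · simpa [h] using this
  · rw [h]
    refine ⟨?_, ?_⟩
    · simpa using this.1
    · simpa [tsum_neg] using this.2

/-- power series attached to a double sequence of coefficients -/
def Phi (A : ℕ → ℕ → ℝ) (x y : ℝ) : PowerSeries ℝ :=
  PowerSeries.mk fun d => ∑ p ∈ antidiagonal d, A p.1 p.2 * x ^ p.1 * y ^ p.2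

/-- scaled coefficients -/
def AN (α : ℝ) (N : ℕ) (a b : ℕ) : ℝ :=
  (4 * (N:ℝ)) ^ (-(1 + α)) * ((4 * (N:ℝ))⁻¹ ^ (a + b) * bc α N a b)

lemma bc_zero (α : ℝ) (N a b : ℕ) (h : N ≤ a ∨ N ≤ b) : bc α N a b = 0 := by
  unfold bc
  rw [Finset.sum_eq_zero, mul_zero]
  intro k hk
  have hk := Finset.mem_range.mp hk
  unfold qk
  rcases h with h | h
  · rw [Nat.descFactorial_of_lt (show k < a by omega)]; simp
  · rw [Nat.descFactorial_of_lt (show k < b by omega)]; simp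

lemma kNp_coeff (α : ℝ) (N : ℕ) (x y : ℝ) (d : ℕ) :
    (kNp α N x y).coeff d = ∑ p ∈ antidiagonal d, x ^ p.1 * bc α N p.1 p.2 * y ^ p.2 := by
  unfold kNp Bmat
  simp only [Polynomial.finsetSum_coeff, Polynomial.coeff_C_mul, Polynomial.coeff_X_pow,
    Matrix.of_apply]
  rw [Fin.sum_univ_eq_sum_range (fun a => ∑ b : Fin N, x ^ a * bc α N a b * y ^ (b:ℕ) *
    (if d = a + b then (1:ℝ) else 0))]
  simp_rw [fun a : ℕ => Fin.sum_univ_eq_sum_range (fun b => x ^ a * bc α N a b * y ^ b *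
    (if d = a + b then (1:ℝ) else 0)) N]
  rw [← Finset.sum_product']
  simp only [mul_ite, mul_one, mul_zero]
  rw [← Finset.sum_filter]
  refine Finset.sum_subset ?_ ?_
  · intro p hp
    simp only [Finset.mem_filter] at hp
    simp [hp.2]
  · intro p hp hp2
    rw [bc_zero α N]
    · simp
    · by_contra hc
      push Not at hc
      apply hp2
      simp only [Finset.mem_filter, Finset.mem_product, Finset.mem_range]
      exact ⟨⟨by omega, by omega⟩, (Finset.HasAntidiagonal.mem_antidiagonal.mp hp).symm⟩

lemma Phi_AN (α : ℝ) (N : ℕ) (x y : ℝ) : Phi (AN α N) x y =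
    (4 * (N:ℝ)) ^ (-(1 + α)) • PowerSeries.rescale (4 * (N:ℝ))⁻¹ (kNp α N x y : PowerSeries ℝ) := by
  ext d
  rw [PowerSeries.coeff_smul, PowerSeries.coeff_rescale, Polynomial.coeff_coe, kNp_coeff]
  simp only [Phi, PowerSeries.coeff_mk, Finset.mul_sum, smul_eq_mul]
  refine Finset.sum_congr rfl fun p hp => ?_
  rw [← Finset.HasAntidiagonal.mem_antidiagonal.mp hp]
  unfold AN; ring

lemma Phi_det (α : ℝ) (N : ℕ) {n : ℕ} (t : Fin n → ℝ) (d : ℕ) :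
    PowerSeries.coeff d (Matrix.det (Matrix.of fun i j : Fin n => Phi (AN α N) (t i) (t j))) =
      ((4 * (N:ℝ)) ^ (-(1 + α))) ^ n * ((4 * (N:ℝ))⁻¹ ^ d * (ep α N t).coeff d) := by
  have h1 : (Matrix.of fun i j : Fin n => Phi (AN α N) (t i) (t j)) =
     (PowerSeries.C ((4 * (N:ℝ)) ^ (-(1 + α)))) • (PowerSeries.rescale (4 * (N:ℝ))⁻¹).mapMatrix
       ((Polynomial.coeToPowerSeries.ringHom (R := ℝ)).mapMatrix
         (Matrix.of fun i j : Fin n => kNp α N (t i) (t j))) := by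
    ext i j : 2
    simp only [Matrix.of_apply, Phi_AN, Matrix.smul_apply, RingHom.mapMatrix_apply, Matrix.map_apply,
      Polynomial.coeToPowerSeries.ringHom_apply]
    rw [PowerSeries.smul_eq_C_mul, smul_eq_mul]
  rw [h1, Matrix.det_smul, ← RingHom.map_det, ← RingHom.map_det, ← map_pow,
    Fintype.card_fin, PowerSeries.coeff_C_mul, PowerSeries.coeff_rescale]
  rw [Polynomial.coeToPowerSeries.ringHom_apply, Polynomial.coeff_coe]; rfl

lemma ep_scale (α : ℝ) (N : ℕ) {n : ℕ} (t : Fin n → ℝ) (s : ℝ) (d : ℕ) :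
    (ep α N (s • t)).coeff d = s ^ d * (ep α N t).coeff d := by
  have h1 : ep α N (s • t) = (ep α N t).comp (Polynomial.C s * Polynomial.X) := by
    refine Polynomial.funext fun u => ?_
    rw [Polynomial.eval_comp, ep_eval, ep_eval, smul_smul]
    simp only [Polynomial.eval_mul, Polynomial.eval_C, Polynomial.eval_X]
    rw [mul_comm]
  rw [h1, Polynomial.comp_C_mul_X_coeff, mul_comm]


/-- limiting coefficients -/
def Ainf (α : ℝ) (a b : ℕ) : ℝ :=
  (-1) ^ (a + b) / (Real.Gamma (a + α + 1) * Real.Gamma (b + α + 1) * a.factorial * b.factorial) *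
    ((4:ℝ) ^ (-(1 + α)) * (4:ℝ)⁻¹ ^ (a + b)) * (1 / ((a:ℝ) + b + α + 1))

lemma AN_eq (α : ℝ) (N a b : ℕ) (hN : 1 ≤ N) : AN α N a b =
  (-1) ^ (a + b) / (Real.Gamma (a + α + 1) * Real.Gamma (b + α + 1) * a.factorial * b.factorial) *
    ((4:ℝ) ^ (-(1 + α)) * (4:ℝ)⁻¹ ^ (a + b)) *
    ((∑ k ∈ range N, qk α a b k) / (N:ℝ) ^ ((a:ℝ) + b + α + 1)) := by
  have hN' : (0:ℝ) < N := by exact_mod_cast hN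
  have h1 : (N:ℝ) ^ ((a:ℝ) + b + α + 1) = (N:ℝ) ^ (a+b) * (N:ℝ) ^ (1 + α) := by
    rw [← Real.rpow_natCast, ← Real.rpow_add hN']; congr 1; push_cast; ring
  unfold AN bc
  rw [h1, Real.mul_rpow (by norm_num) hN'.le, Real.rpow_neg hN'.le, mul_inv, mul_pow,
    inv_pow (N:ℝ)]
  have h2 : (N:ℝ) ^ (1+α) ≠ 0 := (Real.rpow_pos_of_pos hN' _).ne'
  have h3 : (N:ℝ) ^ (a+b) ≠ 0 := by positivity
  rw [div_eq_mul_inv (∑ k ∈ range N, qk α a b k), mul_inv]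
  ring

lemma AN_tendsto {α : ℝ} (hα : -1 < α) (a b : ℕ) :
    Tendsto (fun N => AN α N a b) atTop (𝓝 (Ainf α a b)) := by
  have := (qsum_tendsto hα a b).const_mul ((-1) ^ (a + b) / (Real.Gamma (a + α + 1) *
    Real.Gamma (b + α + 1) * a.factorial * b.factorial) *
    ((4:ℝ) ^ (-(1 + α)) * (4:ℝ)⁻¹ ^ (a + b)))
  refine this.congr' ?_
  filter_upwards [eventually_ge_atTop 1] with N hN
  rw [AN_eq α N a b hN]

def gg (α : ℝ) (a : ℕ) : ℝ := (4:ℝ)⁻¹ ^ a / (Real.Gamma (a + α + 1) * a.factorial)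

lemma gg_nonneg {α : ℝ} (hα : -1 < α) (a : ℕ) : 0 ≤ gg α a := by
  have := gpos hα a
  unfold gg; positivity

lemma AN_bound {α : ℝ} (hα : -1 < α) : ∃ C, 0 ≤ C ∧ ∀ N a b, 1 ≤ N →
    |AN α N a b| ≤ C * (gg α a * gg α b) := by
  obtain ⟨C, hC, h⟩ := qsum_le hα
  refine ⟨(4:ℝ) ^ (-(1+α)) * C, by positivity, fun N a b hN => ?_⟩
  have h1 := gpos hα a
  have h2 := gpos hα b
  have h3 : 0 ≤ (∑ k ∈ range N, qk α a b k) / (N:ℝ) ^ ((a:ℝ) + b + α + 1) :=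
    div_nonneg (Finset.sum_nonneg fun k _ => qk_nonneg hα a b k) (Real.rpow_nonneg (by positivity) _)
  rw [AN_eq α N a b hN, abs_mul, abs_of_nonneg h3]
  have h4 : |(-1) ^ (a + b) / (Real.Gamma (a + α + 1) * Real.Gamma (b + α + 1) * a.factorial * b.factorial) *
    ((4:ℝ) ^ (-(1 + α)) * (4:ℝ)⁻¹ ^ (a + b))| = (4:ℝ) ^ (-(1+α)) * (gg α a * gg α b) := by
    rw [abs_mul, abs_div, abs_pow, abs_neg, abs_one, one_pow, abs_of_pos (by positivity),
      abs_of_pos (by positivity)]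
    unfold gg
    rw [pow_add]
    field_simp
  rw [h4]
  have := gg_nonneg hα a
  have := gg_nonneg hα b
  calc _ ≤ (4:ℝ) ^ (-(1+α)) * (gg α a * gg α b) * C :=
        mul_le_mul_of_nonneg_left (h N a b hN) (by positivity)
    _ = _ := by ring

lemma Ainf_bound {α : ℝ} (hα : -1 < α) : ∃ C, 0 ≤ C ∧ (∀ N a b, 1 ≤ N →
    |AN α N a b| ≤ C * (gg α a * gg α b)) ∧ ∀ a b, |Ainf α a b| ≤ C * (gg α a * gg α b) := by
  obtain ⟨C, hC, h⟩ := AN_bound hα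
  refine ⟨C, hC, h, fun a b => ?_⟩
  refine le_of_tendsto (AN_tendsto hα a b).abs ?_
  filter_upwards [eventually_ge_atTop 1] with N hN
  exact h N a b hN

lemma gamma_lower {α : ℝ} (hα : -1 < α) : ∃ c, 0 < c ∧ ∀ a : ℕ, c ≤ Real.Gamma (a + α + 1) := by
  have h0 := gpos hα 0
  have h1 := gpos hα 1
  refine ⟨min (Real.Gamma ((0:ℕ) + α + 1)) (Real.Gamma ((1:ℕ) + α + 1)), lt_min h0 h1, fun a => ?_⟩
  rcases Nat.eq_zero_or_pos a with rfl | ha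
  · exact min_le_left _ _
  · refine (min_le_right _ _).trans ?_
    induction a, ha using Nat.le_induction with
    | base => exact le_rfl
    | succ a ha ih =>
      refine ih.trans ?_
      have h2 : (0:ℝ) < a + α + 1 := by have : (0:ℝ) ≤ a := a.cast_nonneg; linarith
      have h3 : (1:ℝ) ≤ a := by exact_mod_cast ha
      have : (((a+1:ℕ):ℝ) + α + 1) = (a + α + 1) + 1 := by push_cast; ring
      rw [this, Real.Gamma_add_one h2.ne']
      exact le_mul_of_one_le_left (gpos hα a).le (by linarith)

lemma gg_bound {α : ℝ} (hα : -1 < α) {T ρ : ℝ} (hT : 0 ≤ T) (hρ : 0 < ρ) :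
    ∃ K, 0 ≤ K ∧ ∀ a, gg α a * T ^ a ≤ K * ρ ^ a := by
  obtain ⟨c, hc, h⟩ := gamma_lower hα
  refine ⟨c⁻¹ * Real.exp (4⁻¹ * T / ρ), by positivity, fun a => ?_⟩
  have h1 : (4⁻¹ * T / ρ) ^ a / a.factorial ≤ Real.exp (4⁻¹ * T / ρ) :=
    Real.pow_div_factorial_le_exp _ (by positivity) a
  have h2 : (Real.Gamma (a + α + 1))⁻¹ ≤ c⁻¹ := inv_anti₀ hc (h a)
  have h3 : gg α a * T ^ a = (Real.Gamma (a + α + 1))⁻¹ * ((4⁻¹ * T / ρ) ^ a / a.factorial) * ρ ^ a := by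
    unfold gg
    rw [div_pow, mul_pow]
    have := gpos hα a
    field_simp
  rw [h3]
  refine mul_le_mul_of_nonneg_right ?_ (by positivity)
  exact mul_le_mul h2 h1 (by positivity) (by positivity)

lemma Phi_bd {α : ℝ} (hα : -1 < α) {T ρ C : ℝ} (hT : 0 ≤ T) (hρ : 0 < ρ) (hC : 0 ≤ C) :
    ∃ B, 0 ≤ B ∧ ∀ A : ℕ → ℕ → ℝ, (∀ a b, |A a b| ≤ C * (gg α a * gg α b)) →
      ∀ x y, |x| ≤ T → |y| ≤ T → Bd B ρ (Phi A x y) := by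
  obtain ⟨K, hK, h⟩ := gg_bound hα hT (half_pos hρ)
  refine ⟨C * (K * K), by positivity, fun A hA x y hx hy d => ?_⟩
  rw [Phi, PowerSeries.coeff_mk]
  refine (Finset.abs_sum_le_sum_abs _ _).trans ?_
  have h1 : ∀ p ∈ antidiagonal d, |A p.1 p.2 * x ^ p.1 * y ^ p.2| ≤
      C * (K * K) * (ρ/2) ^ d := fun p hp => by
    rw [abs_mul, abs_mul, abs_pow, abs_pow, ← Finset.HasAntidiagonal.mem_antidiagonal.mp hp, pow_add]
    have g1 := gg_nonneg hα p.1
    have g2 := gg_nonneg hα p.2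
    calc _ ≤ C * (gg α p.1 * gg α p.2) * T ^ p.1 * T ^ p.2 := by
          gcongr
          exact hA _ _
      _ = C * ((gg α p.1 * T ^ p.1) * (gg α p.2 * T ^ p.2)) := by ring
      _ ≤ C * ((K * (ρ/2) ^ p.1) * (K * (ρ/2) ^ p.2)) := by
          refine mul_le_mul_of_nonneg_left (mul_le_mul (h _) (h _) (by positivity) (by positivity)) hC
      _ = _ := by ring
  refine (Finset.sum_le_card_nsmul _ _ _ h1).trans ?_
  rw [Finset.Nat.card_antidiagonal, nsmul_eq_mul, div_pow]
  have h2 : ((d + 1 : ℕ) : ℝ) ≤ 2 ^ d := by exact_mod_cast Nat.lt_two_pow_self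
  have h3 : 0 ≤ C * (K * K) * (ρ ^ d / 2 ^ d) := by positivity
  calc _ ≤ 2 ^ d * (C * (K * K) * (ρ ^ d / 2 ^ d)) := mul_le_mul_of_nonneg_right h2 h3
    _ = _ := by field_simp

lemma Phi_tendsto {α : ℝ} (hα : -1 < α) (x y : ℝ) (d : ℕ) :
    Tendsto (fun N => PowerSeries.coeff d (Phi (AN α N) x y)) atTop
      (𝓝 (PowerSeries.coeff d (Phi (Ainf α) x y))) := by
  simp only [Phi, PowerSeries.coeff_mk]
  exact tendsto_finsetSum _ fun p _ => ((AN_tendsto hα p.1 p.2).mul_const _).mul_const _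

/-- determinant coefficients -/
def edet (A : ℕ → ℕ → ℝ) {n : ℕ} (t : Fin n → ℝ) (d : ℕ) : ℝ :=
  PowerSeries.coeff d (Matrix.det (Matrix.of fun i j : Fin n => Phi A (t i) (t j)))

lemma edet_bound {α : ℝ} (hα : -1 < α) (n : ℕ) {T : ℝ} (hT : 0 ≤ T) :
    ∃ B, 0 ≤ B ∧ (∀ N, 1 ≤ N → ∀ t : Fin n → ℝ, (∀ i, |t i| ≤ T) →
      ∀ d, |edet (AN α N) t d| ≤ B * (1/2) ^ d) := by
  obtain ⟨C, hC, h1, h2⟩ := Ainf_bound hα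
  obtain ⟨B, hB, h⟩ := Phi_bd hα hT (ρ := (1/2)^(n+1)) (by positivity) hC
  refine ⟨n.factorial * B ^ n, by positivity, fun N hN t ht d => ?_⟩
  have := Bd.det (Matrix.of fun i j : Fin n => Phi (AN α N) (t i) (t j)) hB
    (by positivity) (fun i j => h _ (fun a b => h1 N a b hN) _ _ (ht i) (ht j)) d
  have e : (2:ℝ) ^ n * (1/2) ^ (n+1) = 1/2 := by
    rw [pow_succ, ← mul_assoc, ← mul_pow]; norm_num
  rw [e] at this
  exact this

lemma edet_tendsto {α : ℝ} (hα : -1 < α) {n : ℕ} (t : Fin n → ℝ) (d : ℕ) :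
    Tendsto (fun N => edet (AN α N) t d) atTop (𝓝 (edet (Ainf α) t d)) :=
  det_coeff_tendsto _ _ (fun i j d => Phi_tendsto hα (t i) (t j) d) d

lemma Phi_inf_ev {α : ℝ} (hα : -1 < α) (x y : ℝ) :
    Summable (fun d => ‖PowerSeries.coeff d (Phi (Ainf α) x y)‖) := by
  obtain ⟨C, hC, h1, h2⟩ := Ainf_bound hα
  obtain ⟨B, hB, h⟩ := Phi_bd hα (T := max |x| |y|) (ρ := 1/2) (by positivity) (by positivity) hC
  refine Summable.of_nonneg_of_le (fun _ => norm_nonneg _)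
    (fun d => h _ h2 x y (le_max_left _ _) (le_max_right _ _) d) ?_
  exact (summable_geometric_of_lt_one (by norm_num) (by norm_num)).mul_left B

/-- limiting reduced kernel -/
def Kinf (α : ℝ) (x y : ℝ) : ℝ := ∑' d, PowerSeries.coeff d (Phi (Ainf α) x y)

lemma edet_inf_sum {α : ℝ} (hα : -1 < α) {n : ℕ} (t : Fin n → ℝ) :
    ∑' d, edet (Ainf α) t d = Matrix.det (Matrix.of fun i j : Fin n => Kinf α (t i) (t j)) :=
  (Ev.det _ (Matrix.of fun i j : Fin n => Kinf α (t i) (t j))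
    (fun i j => ⟨Phi_inf_ev hα (t i) (t j), rfl⟩)).2


def DD (α : ℝ) (N : ℕ) : ℝ := (N:ℝ) * (N + α)

def GG (α : ℝ) (n N d : ℕ) : ℝ :=
  Real.Gamma (DD α N + 1) / Real.Gamma (DD α N - n * (1 + α) - d + 1) / DD α N ^ (n * (1 + α) + d)

def FF (α : ℝ) (n N d : ℕ) (X : ℝ) : ℝ :=
  GG α n N d * (1 - X / (4 * N * DD α N)) ^ (DD α N - n * (1 + α) - d)

lemma DD_pos {α : ℝ} (hα : -1 < α) {N : ℕ} (hN : 1 ≤ N) : 0 < DD α N := by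
  have : (1:ℝ) ≤ N := by exact_mod_cast hN
  unfold DD
  exact mul_pos (by linarith) (by linarith)

lemma DD_tendsto (α : ℝ) : Tendsto (DD α) atTop atTop := by
  unfold DD
  exact tendsto_natCast_atTop_atTop.atTop_mul_atTop₀
    (tendsto_atTop_add_const_right _ _ tendsto_natCast_atTop_atTop)

lemma DD_sub {α : ℝ} (hα : -1 < α) {n N d : ℕ} (hn : n ≤ N) (hd : d ≤ N * (N - 1)) :
    0 ≤ DD α N - n * (1 + α) - d := by
  obtain ⟨m, rfl⟩ := Nat.exists_eq_add_of_le hn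
  have := M0_eq α n m
  have h1 : (d:ℝ) ≤ ((n+m)*(n+m-1) : ℕ) := by exact_mod_cast hd
  have h2 : 0 ≤ (m:ℝ) * (1+α) := mul_nonneg m.cast_nonneg (by linarith)
  unfold DD
  rw [← this]
  unfold M0; linarith

lemma GG_le {α : ℝ} (hα : -1 < α) {n N : ℕ} (hN : 1 ≤ N) (hn : n ≤ N) (d : ℕ)
    (hd : d ≤ N * (N - 1)) : 0 ≤ GG α n N d ∧ GG α n N d ≤ GG α n N 0 := by
  have hD := DD_pos hα hN
  have hm0 : 0 ≤ (n:ℝ) * (1 + α) := mul_nonneg n.cast_nonneg (by linarith)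
  have h0 : 0 ≤ GG α n N d := by
    have h1 := DD_sub hα hn hd
    have h2 : 0 < Real.Gamma (DD α N - n * (1 + α) - d + 1) := Real.Gamma_pos_of_pos (by linarith)
    have h3 : 0 < Real.Gamma (DD α N + 1) := Real.Gamma_pos_of_pos (by linarith)
    unfold GG; positivity
  refine ⟨h0, ?_⟩
  clear h0
  induction d with
  | zero => exact le_rfl
  | succ d ih =>
    refine le_trans ?_ (ih (by omega))
    have h1 := DD_sub hα hn hd
    have h2 : 0 < DD α N - n * (1 + α) - d := by push_cast at h1; linarith
    have h3 : 0 < Real.Gamma (DD α N - n * (1 + α) - d) := Real.Gamma_pos_of_pos h2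
    have h4 : 0 < Real.Gamma (DD α N + 1) := Real.Gamma_pos_of_pos (by linarith)
    have h5 : 0 < DD α N ^ ((n:ℝ) * (1 + α) + d) := Real.rpow_pos_of_pos hD _
    unfold GG
    rw [Real.Gamma_add_one h2.ne', show DD α N - n * (1 + α) - ((d+1:ℕ):ℝ) + 1 =
      DD α N - n * (1 + α) - d by push_cast; ring,
      show (n:ℝ) * (1 + α) + ((d+1:ℕ):ℝ) = (n * (1 + α) + d) + 1 by push_cast; ring,
      Real.rpow_add_one hD.ne', div_div, div_div]
    apply div_le_div_of_nonneg_left h4.le (by positivity)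
    have h6 : DD α N - n * (1 + α) - d ≤ DD α N := by
      have : (0:ℝ) ≤ d := d.cast_nonneg
      linarith
    calc _ = (Real.Gamma (DD α N - n * (1 + α) - d) * DD α N ^ ((n:ℝ) * (1 + α) + d)) *
          (DD α N - n * (1 + α) - d) := by ring
      _ ≤ (Real.Gamma (DD α N - n * (1 + α) - d) * DD α N ^ ((n:ℝ) * (1 + α) + d)) * DD α N :=
          mul_le_mul_of_nonneg_left h6 (by positivity)
      _ = _ := by ring

lemma GG_tendsto {α : ℝ} (hα : -1 < α) (n d : ℕ) : Tendsto (fun N => GG α n N d) atTop (𝓝 1) := by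
  have h1 := (gamma_ratio 1).comp (DD_tendsto α)
  have h2 := (gamma_ratio (1 - (n * (1 + α) + d))).comp (DD_tendsto α)
  have h3 := h1.div h2 one_ne_zero
  rw [div_one] at h3
  refine h3.congr' ?_
  filter_upwards [eventually_ge_atTop 1] with N hN
  have hD := DD_pos hα hN
  have h5 : 0 < DD α N ^ ((n:ℝ) * (1 + α) + d) := Real.rpow_pos_of_pos hD _
  have h6 : 0 < Real.Gamma (DD α N) := Real.Gamma_pos_of_pos hD
  simp only [Pi.div_apply, Function.comp]
  unfold GG
  rw [show DD α N + (1 - (n * (1 + α) + d)) = DD α N - n * (1 + α) - d + 1 by ring,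
    Real.rpow_sub hD, Real.rpow_one]
  field_simp

lemma one_sub_rpow_bd {e p : ℝ} (he : 0 ≤ e) (he1 : e ≤ 1) (hp : 0 ≤ p) :
    0 ≤ (1 - e) ^ p ∧ (1 - e) ^ p ≤ 1 :=
  ⟨Real.rpow_nonneg (by linarith) _, Real.rpow_le_one (by linarith) (by linarith) hp⟩

lemma FF_tendsto {α : ℝ} (hα : -1 < α) (n d : ℕ) {X : ℝ} (hX : 0 ≤ X) :
    Tendsto (fun N => FF α n N d X) atTop (𝓝 1) := by
  have hm0 : 0 ≤ (n:ℝ) * (1 + α) := mul_nonneg n.cast_nonneg (by linarith)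
  have hd0 : (0:ℝ) ≤ d := d.cast_nonneg
  have h1 : Tendsto (fun N : ℕ => (1 - X / (4 * N * DD α N)) ^ (DD α N - n * (1 + α) - d))
      atTop (𝓝 1) := by
    have hl : Tendsto (fun N : ℕ => 1 - X / 4 / (N:ℝ)) atTop (𝓝 1) := by
      have := (tendsto_const_div_atTop_nhds_zero_nat (X/4)).const_sub 1
      simpa using this
    have hev : ∀ᶠ N : ℕ in atTop, X / 4 / (N:ℝ) < 1 := by
      have := (tendsto_const_div_atTop_nhds_zero_nat (X/4))
      exact this.eventually_lt_const one_pos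
    have hev2 := (DD_tendsto α).eventually_ge_atTop (n * (1 + α) + d + 1)
    refine tendsto_of_tendsto_of_tendsto_of_le_of_le' hl tendsto_const_nhds ?_ ?_ <;>
    filter_upwards [eventually_ge_atTop 1, hev, hev2] with N hN h1 h2
    all_goals
      have hD := DD_pos hα hN
      have hD1 : 1 ≤ DD α N := by linarith
      have hN' : (0:ℝ) < N := by exact_mod_cast hN
      have e0 : 0 ≤ X / (4 * N * DD α N) := by positivity
      have e1 : DD α N * (X / (4 * N * DD α N)) = X / 4 / N := by field_simp
      have e2 : X / (4 * N * DD α N) ≤ 1 := by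
        have : 1 * (X / (4 * N * DD α N)) ≤ DD α N * (X / (4 * N * DD α N)) :=
          mul_le_mul_of_nonneg_right hD1 e0
        linarith
    · have := one_add_mul_self_le_rpow_one_add (s := -(X / (4 * N * DD α N))) (by linarith)
        (p := DD α N - n * (1 + α) - d) (by linarith)
      rw [← sub_eq_add_neg] at this
      refine le_trans ?_ this
      have : (DD α N - n * (1 + α) - d) * (X / (4 * N * DD α N)) ≤ DD α N * (X / (4 * N * DD α N)) :=
        mul_le_mul_of_nonneg_right (by linarith) e0
      linarith
    · exact (one_sub_rpow_bd e0 e2 (by linarith)).2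
  have := (GG_tendsto hα n d).mul h1
  simpa only [FF, mul_one] using this

lemma R_scaled {α : ℝ} (hα : -1 < α) {n N : ℕ} (hN : 1 ≤ N) (hn : n ≤ N) (t : Fin n → ℝ)
    (ht : ∀ i, 0 < t i) (hX : (∑ i, t i) < 4 * N * DD α N) :
    btlueR α N n (((N : ℝ) + α) / 4) (fun i => t i / (16 * (N : ℝ) ^ 2)) / (16 * (N : ℝ) ^ 2) ^ n =
      (∏ i, t i ^ α) * ∑' d, edet (AN α N) t d * FF α n N d (∑ i, t i) := by
  have hD := DD_pos hα hN
  have hN' : (0:ℝ) < N := by exact_mod_cast hN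
  have hNα : 0 < (N:ℝ) + α := by
    have : (1:ℝ) ≤ N := by exact_mod_cast hN
    linarith
  set q : ℝ := 4 * N with hq
  have hq0 : 0 < q := by positivity
  have hq2 : 16 * (N:ℝ)^2 = q ^ 2 := by rw [hq]; ring
  have hr : ((N:ℝ) + α) / 4 = DD α N / q := by rw [hq, DD]; field_simp
  have hr0 : 0 < DD α N / q := by positivity
  have hst : (fun i => t i / (16 * (N : ℝ) ^ 2)) = (q^2)⁻¹ • t := by
    funext i; rw [hq2]; simp [div_eq_inv_mul]
  have hsum : ∑ i, ((q^2)⁻¹ • t) i = (DD α N / q) * ((∑ i, t i) / (q * DD α N)) := by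
    simp only [Pi.smul_apply, smul_eq_mul, ← Finset.mul_sum]
    field_simp
  have hlt : (∑ i, t i) / (q * DD α N) < 1 := by
    rw [div_lt_one (by positivity)]; exact hX
  rw [hst, hr, btlueR_formula hα hn _ (fun i => by have := ht i; simp; positivity) hr0 (by
    rw [hsum]
    exact mul_lt_of_lt_one_right hr0 hlt), hsum, hq2, mul_div_assoc, ← tsum_div_const]
  have hprod : ∏ i, ((q^2)⁻¹ • t) i ^ α = (q ^ (-2 * n * α)) * ∏ i, t i ^ α := by
    simp only [Pi.smul_apply, smul_eq_mul]
    rw [Finset.prod_congr rfl fun i _ => Real.mul_rpow (by positivity) (ht i).le,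
      Finset.prod_mul_distrib, Finset.prod_const, Finset.card_univ, Fintype.card_fin]
    congr 1
    rw [← Real.rpow_natCast q 2, ← Real.rpow_neg hq0.le, ← Real.rpow_mul hq0.le,
      ← Real.rpow_mul_natCast hq0.le]
    congr 1; push_cast; ring
  rw [hprod, mul_comm (q ^ (-2 * n * α)), mul_assoc]
  congr 1
  rw [← tsum_mul_left]
  refine tsum_congr fun d => ?_
  rw [edet, Phi_det, ep_scale, ← hq, FF, GG, ← hq]
  have hDD : (N:ℝ) * (N + α) = DD α N := rfl
  rw [hDD]
  set e := (∑ i, t i) / (q * DD α N)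
  have he : 0 < 1 - e := by linarith
  rw [show DD α N / q - DD α N / q * e = DD α N / q * (1 - e) by ring,
    Real.mul_rpow hr0.le he.le]
  have k1 : (DD α N / q) ^ (DD α N - n * (1 + α) - d) / (DD α N / q) ^ (DD α N) =
      q ^ (n * (1 + α) + d) / DD α N ^ (n * (1 + α) + d) := by
    rw [← Real.rpow_sub hr0, show DD α N - n * (1 + α) - d - DD α N = -(n * (1 + α) + d) by ring,
      Real.rpow_neg hr0.le, Real.div_rpow hD.le hq0.le, inv_div]
  have k2 : q ^ (-2 * (n:ℝ) * α) * (q^2)⁻¹ ^ d * q ^ ((n:ℝ) * (1 + α) + d) / (q ^ 2) ^ n =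
      (q ^ (-(1 + α))) ^ n * q⁻¹ ^ d := by
    simp only [← Real.rpow_natCast, ← Real.rpow_neg hq0.le, ← Real.rpow_mul hq0.le, ← Real.rpow_neg_one q,
      ← Real.rpow_add hq0, ← Real.rpow_sub hq0]
    congr 1; push_cast; ring
  have k3 : ((DD α N / q) ^ (DD α N - n * (1 + α) - d) * (1 - e) ^ (DD α N - n * (1 + α) - d)) /
      (DD α N / q) ^ (DD α N) = q ^ (n * (1 + α) + d) / DD α N ^ (n * (1 + α) + d) *
        (1 - e) ^ (DD α N - n * (1 + α) - d) := by
    rw [← k1]; ring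
  rw [k3, ← mul_assoc (((q ^ (-(1 + α))) ^ n)), ← k2]
  ring


lemma edet_zero {α : ℝ} (hα : -1 < α) {n N : ℕ} (hn : n ≤ N) (t : Fin n → ℝ) {d : ℕ}
    (hd : N * (N - 1) < d) : edet (AN α N) t d = 0 := by
  obtain ⟨m, rfl⟩ := Nat.exists_eq_add_of_le hn
  rw [edet, Phi_det, ep_coeff_zero hα t d (by simpa using hd)]
  simp

lemma term_bound {α : ℝ} (hα : -1 < α) {n N : ℕ} (hN : 1 ≤ N) (hn : n ≤ N) (t : Fin n → ℝ)
    (ht : ∀ i, 0 < t i) (hX : (∑ i, t i) < 4 * N * DD α N) (hG : GG α n N 0 ≤ 2) {B : ℝ}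
    (hB : ∀ d, |edet (AN α N) t d| ≤ B * (1/2) ^ d) (d : ℕ) :
    ‖edet (AN α N) t d * FF α n N d (∑ i, t i)‖ ≤ (B * 2) * (1/2) ^ d := by
  have hD := DD_pos hα hN
  have hN' : (0:ℝ) < N := by exact_mod_cast hN
  have hB0 : 0 ≤ B * (1/2) ^ d := (abs_nonneg _).trans (hB d)
  by_cases hd : d ≤ N * (N - 1)
  · obtain ⟨g0, g1⟩ := GG_le hα hN hn d hd
    have hs : 0 ≤ ∑ i, t i := Finset.sum_nonneg fun i _ => (ht i).le
    have e0 : 0 ≤ (∑ i, t i) / (4 * N * DD α N) := by positivity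
    have e1 : (∑ i, t i) / (4 * N * DD α N) ≤ 1 := by
      rw [div_le_one (by positivity)]; exact hX.le
    obtain ⟨p0, p1⟩ := one_sub_rpow_bd e0 e1 (DD_sub hα hn hd)
    have hF : |FF α n N d (∑ i, t i)| ≤ 2 := by
      unfold FF
      rw [abs_of_nonneg (mul_nonneg g0 p0)]
      calc _ ≤ GG α n N d * 1 := mul_le_mul_of_nonneg_left p1 g0
        _ ≤ 2 := by linarith
    rw [norm_mul, Real.norm_eq_abs, Real.norm_eq_abs]
    calc _ ≤ (B * (1/2) ^ d) * 2 := mul_le_mul (hB d) hF (abs_nonneg _) hB0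
      _ = _ := by ring
  · rw [edet_zero hα hn t (not_le.mp hd), zero_mul, norm_zero]
    linarith

lemma ev_cond {α : ℝ} (hα : -1 < α) (n : ℕ) (S : ℝ) : ∀ᶠ N : ℕ in atTop,
    1 ≤ N ∧ n ≤ N ∧ S < 4 * N * DD α N ∧ GG α n N 0 ≤ 2 := by
  have h1 := (GG_tendsto hα n 0).eventually_lt_const one_lt_two
  have h2 := (DD_tendsto α).eventually_gt_atTop S
  filter_upwards [eventually_ge_atTop 1, eventually_ge_atTop n, h1, h2] with N a b c e
  refine ⟨a, b, ?_, c.le⟩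
  have : (1:ℝ) ≤ N := by exact_mod_cast a
  have hD := DD_pos hα a
  nlinarith

lemma R_lim {α : ℝ} (hα : -1 < α) {n : ℕ} (t : Fin n → ℝ) (ht : ∀ i, 0 < t i) :
    Tendsto (fun N : ℕ => btlueR α N n (((N : ℝ) + α) / 4)
        (fun i => t i / (16 * (N : ℝ) ^ 2)) / (16 * (N : ℝ) ^ 2) ^ n) atTop
      (𝓝 ((∏ i, t i ^ α) * Matrix.det (Matrix.of fun i j : Fin n => Kinf α (t i) (t j)))) := by
  have hs : 0 ≤ ∑ i, t i := Finset.sum_nonneg fun i _ => (ht i).le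
  obtain ⟨B, hB, hb⟩ := edet_bound hα n hs
  have hti : ∀ i, |t i| ≤ ∑ i, t i := fun i => by
    rw [abs_of_pos (ht i)]
    exact Finset.single_le_sum (f := t) (fun i _ => (ht i).le) (Finset.mem_univ i)
  have key : Tendsto (fun N : ℕ => ∑' d, edet (AN α N) t d * FF α n N d (∑ i, t i)) atTop
      (𝓝 (∑' d, edet (Ainf α) t d)) := by
    refine tendsto_tsum_of_dominated_convergence (bound := fun d => (B * 2) * (1/2) ^ d)
      ((summable_geometric_of_lt_one (by norm_num) (by norm_num)).mul_left _) ?_ ?_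
    · intro d
      have := (edet_tendsto hα t d).mul (FF_tendsto hα n d hs)
      simpa only [mul_one] using this
    · filter_upwards [ev_cond hα n (∑ i, t i)] with N hN d
      exact term_bound hα hN.1 hN.2.1 t ht hN.2.2.1 hN.2.2.2 (hb N hN.1 t hti) d
  rw [← edet_inf_sum hα]
  refine (key.const_mul (∏ i, t i ^ α)).congr' ?_
  filter_upwards [ev_cond hα n (∑ i, t i)] with N hN
  rw [R_scaled hα hN.1 hN.2.1 t ht hN.2.2.1]

lemma R_bound {α : ℝ} (hα : -1 < α) (n : ℕ) {T : ℝ} (hT : 0 ≤ T) : ∃ C, 0 ≤ C ∧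
    ∀ᶠ N : ℕ in atTop, ∀ t : Fin n → ℝ, (∀ i, 0 < t i ∧ t i ≤ T) →
      ‖btlueR α N n (((N : ℝ) + α) / 4)
        (fun i => t i / (16 * (N : ℝ) ^ 2)) / (16 * (N : ℝ) ^ 2) ^ n‖ ≤ C * ∏ i, t i ^ α := by
  obtain ⟨B, hB, hb⟩ := edet_bound hα n hT
  refine ⟨(B * 2) * ∑' d : ℕ, (1/2:ℝ) ^ d, by positivity, ?_⟩
  filter_upwards [ev_cond hα n (n * T)] with N hN t ht
  have hX : (∑ i, t i) < 4 * N * DD α N := by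
    refine lt_of_le_of_lt ?_ hN.2.2.1
    have := Finset.sum_le_card_nsmul Finset.univ t T (fun i _ => (ht i).2)
    simpa using this
  have ht0 : ∀ i, 0 < t i := fun i => (ht i).1
  rw [R_scaled hα hN.1 hN.2.1 t ht0 hX, norm_mul, mul_comm,
    Real.norm_of_nonneg (Finset.prod_nonneg fun i _ => Real.rpow_nonneg (ht0 i).le _)]
  refine mul_le_mul_of_nonneg_right ?_ (Finset.prod_nonneg fun i _ => Real.rpow_nonneg (ht0 i).le _)
  refine tsum_of_norm_bounded (((summable_geometric_of_lt_one (by norm_num) (by norm_num)).hasSum).mul_left _) ?_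
  intro d
  exact term_bound hα hN.1 hN.2.1 t ht0 hX hN.2.2.2
    (hb N hN.1 t fun i => by rw [abs_of_pos (ht0 i)]; exact (ht i).2) d


def cc (α : ℝ) (a : ℕ) : ℝ := (-1) ^ a * (4:ℝ)⁻¹ ^ a / (Real.Gamma (a + α + 1) * a.factorial)

lemma cc_abs {α : ℝ} (hα : -1 < α) (a : ℕ) : |cc α a| = gg α a := by
  have := gpos hα a
  unfold cc gg
  rw [abs_div, abs_mul, abs_pow, abs_neg, abs_one, one_pow, one_mul, abs_of_pos (by positivity),
    abs_of_pos (by positivity)]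

lemma cc_succ {α : ℝ} (hα : -1 < α) (a : ℕ) :
    -4 * ((a+1:ℕ):ℝ) * (((a+1:ℕ):ℝ) + α) * cc α (a+1) = cc α a := by
  have h1 := gpos hα a
  have h2 : (0:ℝ) < a + α + 1 := by have : (0:ℝ) ≤ a := a.cast_nonneg; linarith
  unfold cc
  rw [show (((a+1:ℕ):ℝ) + α + 1) = (a + α + 1) + 1 by push_cast; ring, Real.Gamma_add_one h2.ne',
    Nat.factorial_succ, pow_succ, pow_succ]
  push_cast
  have h3 : (0:ℝ) < a + 1 := by positivity
  field_simp
  ring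

lemma cc_bound {α : ℝ} (hα : -1 < α) {T : ℝ} (hT : 0 ≤ T) : ∃ K, 0 ≤ K ∧ ∀ a : ℕ,
    ((a:ℝ) + 1) * |cc α a| * T ^ a ≤ K * (1/2) ^ a := by
  obtain ⟨K, hK, h⟩ := gg_bound hα hT (ρ := 1/4) (by norm_num)
  refine ⟨K, hK, fun a => ?_⟩
  rw [cc_abs hα]
  have h2 : (a:ℝ) + 1 ≤ 2 ^ a := by exact_mod_cast Nat.lt_two_pow_self
  have h3 : 0 ≤ gg α a * T ^ a := mul_nonneg (gg_nonneg hα a) (by positivity)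
  calc _ = ((a:ℝ) + 1) * (gg α a * T ^ a) := by ring
    _ ≤ 2 ^ a * (K * (1/4) ^ a) := mul_le_mul h2 (h a) h3 (by positivity)
    _ = K * (2 * (1/4)) ^ a := by rw [mul_pow]; ring
    _ = _ := by norm_num

lemma geo_sum (K : ℝ) : Summable (fun a : ℕ => K * (1/2:ℝ) ^ a) :=
  (summable_geometric_of_lt_one (by norm_num) (by norm_num)).mul_left K

lemma cc_sum {α : ℝ} (hα : -1 < α) (x : ℝ) : Summable (fun a => ‖cc α a * x ^ a‖) := by
  obtain ⟨K, hK, h⟩ := cc_bound hα (abs_nonneg x)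
  refine Summable.of_nonneg_of_le (fun _ => norm_nonneg _) (fun a => ?_) (geo_sum K)
  rw [norm_mul, norm_pow, Real.norm_eq_abs, Real.norm_eq_abs]
  refine le_trans ?_ (h a)
  have : 0 ≤ |cc α a| * |x| ^ a := by positivity
  have h0 : (0:ℝ) ≤ a := a.cast_nonneg
  nlinarith

lemma cc_sum' {α : ℝ} (hα : -1 < α) (x : ℝ) : Summable (fun a : ℕ => ‖(a:ℝ) * cc α a * x ^ a‖) := by
  obtain ⟨K, hK, h⟩ := cc_bound hα (abs_nonneg x)
  refine Summable.of_nonneg_of_le (fun _ => norm_nonneg _) (fun a => ?_) (geo_sum K)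
  rw [norm_mul, norm_mul, norm_pow, Real.norm_eq_abs, Real.norm_eq_abs, Real.norm_eq_abs, Nat.abs_cast]
  refine le_trans ?_ (h a)
  have : 0 ≤ |cc α a| * |x| ^ a := by positivity
  nlinarith

def PP (α x : ℝ) : ℝ := ∑' a, cc α a * x ^ a
def QQ (α x : ℝ) : ℝ := ∑' a : ℕ, (a:ℝ) * cc α a * x ^ a

lemma PP_deriv {α : ℝ} (hα : -1 < α) (x : ℝ) : ∃ p', HasDerivAt (PP α) p' x ∧ x * p' = QQ α x := by
  obtain ⟨K, hK, h⟩ := cc_bound hα (T := |x| + 1) (by positivity)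
  refine ⟨∑' a : ℕ, cc α a * ((a:ℝ) * x ^ (a - 1)), ?_, ?_⟩
  · refine hasDerivAt_tsum_of_isPreconnected (u := fun a => K * (1/2) ^ a)
      (g := fun a y => cc α a * y ^ a) (g' := fun a y => cc α a * ((a:ℝ) * y ^ (a - 1)))
      (t := Metric.ball 0 (|x| + 1)) (y₀ := x) (geo_sum K) Metric.isOpen_ball
      (convex_ball _ _).isPreconnected ?_ ?_ (by simp) (cc_sum hα x).of_norm (by simp)
    · intro a y _
      exact (hasDerivAt_pow a y).const_mul _
    · intro a y hy
      have hy' : |y| ≤ |x| + 1 := by simpa using (le_of_lt (by simpa using hy) : |y| ≤ |x| + 1)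
      refine le_trans ?_ (h a)
      rw [norm_mul, norm_mul, norm_pow, Real.norm_eq_abs, Real.norm_eq_abs, Real.norm_eq_abs, Nat.abs_cast]
      have h1 : |y| ^ (a - 1) ≤ (|x| + 1) ^ a :=
        (pow_le_pow_left₀ (abs_nonneg y) hy' _).trans
          (pow_le_pow_right₀ (by linarith [abs_nonneg x]) (Nat.sub_le _ _))
      calc |cc α a| * ((a:ℝ) * |y| ^ (a-1)) ≤ |cc α a| * (((a:ℝ) + 1) * (|x| + 1) ^ a) := by
            gcongr; linarith
        _ = _ := by ring
  · unfold QQ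
    rw [← tsum_mul_left]
    refine tsum_congr fun a => ?_
    rcases a with _ | a
    · simp
    · rw [Nat.add_sub_cancel, pow_succ]; ring

lemma bessel_eq (α : ℝ) {x : ℝ} (hx : 0 < x) : besselJ α x = (x/2) ^ α * PP α (x^2) := by
  unfold besselJ PP
  rw [← tsum_mul_left]
  refine tsum_congr fun m => ?_
  rw [Real.rpow_add (by positivity), Real.rpow_mul (by positivity), Real.rpow_natCast]
  unfold cc
  have : (x/2) ^ (2:ℝ) = 4⁻¹ * x^2 := by
    rw [Real.rpow_two]; ring
  rw [this, mul_pow]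
  have : ((m.factorial : ℝ) * Real.Gamma (m + α + 1))⁻¹ = (Real.Gamma (m + α + 1) * m.factorial)⁻¹ := by
    rw [mul_comm]
  rw [div_eq_mul_inv, this]; ring

lemma bessel_deriv {α : ℝ} (hα : -1 < α) {x : ℝ} (hx : 0 < x) :
    x * deriv (besselJ α) x = (x/2) ^ α * (α * PP α (x^2) + 2 * QQ α (x^2)) := by
  obtain ⟨p', h1, h2⟩ := PP_deriv hα (x^2)
  have h3 : HasDerivAt (fun y : ℝ => (y/2) ^ α) (1/2 * α * (x/2) ^ (α - 1)) x := by
    have := ((hasDerivAt_id x).div_const 2).rpow_const (p := α) (Or.inl (by simp; positivity))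
    simpa using this
  have h4 : HasDerivAt (fun y : ℝ => PP α (y^2)) (p' * (2 * x)) x := by
    have := HasDerivAt.comp (h₂ := PP α) (h := fun y : ℝ => y^2) x h1 (by simpa using hasDerivAt_pow 2 x)
    exact this
  have h5 := h3.mul h4
  have h6 : besselJ α =ᶠ[𝓝 x] (fun y : ℝ => (y/2) ^ α) * (fun y : ℝ => PP α (y^2)) := by
    filter_upwards [lt_mem_nhds hx] with y hy
    simp only [Pi.mul_apply]
    exact bessel_eq α hy
  rw [h6.deriv_eq, h5.deriv, ← h2, Real.rpow_sub_one (by positivity)]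
  field_simp

lemma KOff {α : ℝ} (hα : -1 < α) {u v : ℝ} (hu : 0 < u) (hv : 0 < v) (huv : u ≠ v) :
    KBesselOff α u v = u ^ (α/2) * v ^ (α/2) *
      ((4:ℝ) ^ (-α) * (PP α u * QQ α v - PP α v * QQ α u)) / (u - v) := by
  have hsu := Real.sqrt_pos.mpr hu
  have hsv := Real.sqrt_pos.mpr hv
  have e : ∀ w : ℝ, 0 < w → (Real.sqrt w / 2) ^ α = w ^ (α/2) * 2 ^ (-α) := fun w hw => by
    rw [Real.div_rpow (Real.sqrt_nonneg _) (by norm_num), Real.sqrt_eq_rpow, ← Real.rpow_mul hw.le,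
      Real.rpow_neg (by norm_num)]
    rw [div_eq_mul_inv]; congr 2; ring
  have h4 : (4:ℝ) ^ (-α) = 2 ^ (-α) * 2 ^ (-α) := by
    rw [← Real.mul_rpow (by norm_num) (by norm_num)]; norm_num
  unfold KBesselOff
  rw [mul_assoc, mul_assoc, bessel_deriv hα hsu, bessel_deriv hα hsv, bessel_eq α hsu,
    bessel_eq α hsv, Real.sq_sqrt hu.le, Real.sq_sqrt hv.le, e u hu, e v hv, h4]
  have : u - v ≠ 0 := sub_ne_zero.mpr huv
  field_simp
  ring

lemma Ainf_cc {α : ℝ} (hα : -1 < α) (a b : ℕ) : Ainf α a b =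
    (4:ℝ) ^ (-(1+α)) * (1 / ((a:ℝ) + b + α + 1)) * (cc α a * cc α b) := by
  have h1 := gpos hα a
  have h2 := gpos hα b
  unfold Ainf cc
  rw [pow_add, pow_add]
  field_simp

lemma level {α : ℝ} (hα : -1 < α) (u v : ℝ) (d : ℕ) :
    (u - v) * PowerSeries.coeff d (Phi (Ainf α) u v) =
      (4:ℝ) ^ (-α) * ∑ p ∈ antidiagonal (d+1),
        ((cc α p.1 * u ^ p.1) * ((p.2:ℝ) * cc α p.2 * v ^ p.2) -
          ((p.1:ℝ) * cc α p.1 * u ^ p.1) * (cc α p.2 * v ^ p.2)) := by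
  have hd : (0:ℝ) < d + α + 1 := by have : (0:ℝ) ≤ d := d.cast_nonneg; linarith
  have h4 : (4:ℝ) ^ (-(1+α)) = 4 ^ (-α) / 4 := by
    rw [show -(1+α) = -α - 1 by ring, Real.rpow_sub_one (by norm_num)]
  set e : ℕ → ℝ := fun i => -4 * (i:ℝ) * ((i:ℝ) + α) * cc α i with he
  have e0 : e 0 = 0 := by simp [he]
  have es : ∀ i, e (i+1) = cc α i := fun i => cc_succ hα i
  have s1 : ∑ p ∈ antidiagonal (d+1), (e p.1 * u ^ p.1) * (cc α p.2 * v ^ p.2) =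
      u * ∑ p ∈ antidiagonal d, cc α p.1 * u ^ p.1 * (cc α p.2 * v ^ p.2) := by
    rw [Finset.Nat.sum_antidiagonal_succ, e0, Finset.mul_sum]
    simp only [es, zero_mul, zero_add]
    refine Finset.sum_congr rfl fun p _ => ?_
    ring
  have s2 : ∑ p ∈ antidiagonal (d+1), (cc α p.1 * u ^ p.1) * (e p.2 * v ^ p.2) =
      v * ∑ p ∈ antidiagonal d, cc α p.1 * u ^ p.1 * (cc α p.2 * v ^ p.2) := by
    rw [Finset.Nat.sum_antidiagonal_succ', e0, Finset.mul_sum]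
    simp only [es, zero_mul, mul_zero, zero_add]
    refine Finset.sum_congr rfl fun p _ => ?_
    ring
  have s3 : PowerSeries.coeff d (Phi (Ainf α) u v) = (4:ℝ) ^ (-α) / 4 / (d + α + 1) *
      ∑ p ∈ antidiagonal d, cc α p.1 * u ^ p.1 * (cc α p.2 * v ^ p.2) := by
    rw [Phi, PowerSeries.coeff_mk, Finset.mul_sum]
    refine Finset.sum_congr rfl fun p hp => ?_
    rw [Ainf_cc hα, h4, ← Finset.HasAntidiagonal.mem_antidiagonal.mp hp]
    push_cast; ring
  rw [s3, mul_left_comm, sub_mul, ← s1, ← s2, ← Finset.sum_sub_distrib, Finset.mul_sum, Finset.mul_sum]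
  refine Finset.sum_congr rfl fun p hp => ?_
  have hp' : (p.1:ℝ) + p.2 = d + 1 := by exact_mod_cast Finset.HasAntidiagonal.mem_antidiagonal.mp hp
  have hd' : (d:ℝ) = p.1 + p.2 - 1 := by linarith
  rw [hd'] at hd ⊢
  have hd2 : (p.1:ℝ) + p.2 - 1 + α + 1 ≠ 0 := hd.ne'
  simp only [he]
  field_simp
  ring

lemma CD {α : ℝ} (hα : -1 < α) (u v : ℝ) :
    (u - v) * Kinf α u v = (4:ℝ) ^ (-α) * (PP α u * QQ α v - PP α v * QQ α u) := by
  have h1 := tsum_mul_tsum_eq_tsum_sum_antidiagonal_of_summable_norm (cc_sum hα u) (cc_sum' hα v)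
  have h2 := tsum_mul_tsum_eq_tsum_sum_antidiagonal_of_summable_norm (cc_sum' hα u) (cc_sum hα v)
  have m1 := (summable_norm_sum_mul_antidiagonal_of_summable_norm (cc_sum hα u) (cc_sum' hα v)).of_norm
  have m2 := (summable_norm_sum_mul_antidiagonal_of_summable_norm (cc_sum' hα u) (cc_sum hα v)).of_norm
  have h3 : PP α u * QQ α v - PP α v * QQ α u = ∑' d, ∑ p ∈ antidiagonal d,
        ((cc α p.1 * u ^ p.1) * ((p.2:ℝ) * cc α p.2 * v ^ p.2) -
          ((p.1:ℝ) * cc α p.1 * u ^ p.1) * (cc α p.2 * v ^ p.2)) := by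
    unfold PP QQ
    rw [mul_comm (∑' a, cc α a * v ^ a), h1, h2, ← m1.tsum_sub m2]
    refine tsum_congr fun d => ?_
    rw [Finset.sum_sub_distrib]
  have m3 : Summable (fun d => ∑ p ∈ antidiagonal d,
        ((cc α p.1 * u ^ p.1) * ((p.2:ℝ) * cc α p.2 * v ^ p.2) -
          ((p.1:ℝ) * cc α p.1 * u ^ p.1) * (cc α p.2 * v ^ p.2))) := by
    refine (m1.sub m2).congr fun d => ?_
    rw [Finset.sum_sub_distrib]
  rw [h3, m3.tsum_eq_zero_add]
  simp only [Finset.Nat.antidiagonal_zero, Finset.sum_singleton, Nat.cast_zero, zero_mul, mul_zero, sub_zero, zero_add]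
  rw [← tsum_mul_left, Kinf, ← tsum_mul_left]
  exact tsum_congr fun d => level hα u v d

lemma Kinf_cont {α : ℝ} (hα : -1 < α) (u : ℝ) : Continuous (fun w => Kinf α u w) := by
  rw [continuous_iff_continuousAt]
  intro v
  obtain ⟨C, hC, h1, h2⟩ := Ainf_bound hα
  obtain ⟨B, hB, h⟩ := Phi_bd hα (T := |u| + |v| + 1) (ρ := 1/2) (by positivity) (by positivity) hC
  have : ContinuousOn (fun w => Kinf α u w) (Metric.ball v 1) := by
    unfold Kinf
    refine continuousOn_tsum (u := fun d => B * (1/2) ^ d) (fun d => ?_) (geo_sum B) (fun d w hw => ?_)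
    · simp only [Phi, PowerSeries.coeff_mk]
      fun_prop
    · refine h _ h2 u w (by linarith [abs_nonneg v]) ?_ d
      have : |w - v| < 1 := by simpa [Real.dist_eq] using hw
      have h3 := abs_add_le (w - v) v
      rw [sub_add_cancel] at h3
      linarith [abs_nonneg u]
  exact this.continuousAt (Metric.ball_mem_nhds v one_pos)

lemma KB_eq {α : ℝ} (hα : -1 < α) {u v : ℝ} (hu : 0 < u) (hv : 0 < v) :
    KBessel α u v = u ^ (α/2) * v ^ (α/2) * Kinf α u v := by
  have off : ∀ w, 0 < w → u ≠ w → KBesselOff α u w = u ^ (α/2) * w ^ (α/2) * Kinf α u w := by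
    intro w hw hne
    have : u - w ≠ 0 := sub_ne_zero.mpr hne
    rw [KOff hα hu hw hne, ← CD hα]
    field_simp
  unfold KBessel
  split_ifs with h
  · subst h
    refine Tendsto.limUnder_eq ?_
    have hc : ContinuousAt (fun w => u ^ (α/2) * w ^ (α/2) * Kinf α u w) u := by
      refine ContinuousAt.mul (ContinuousAt.mul continuousAt_const ?_) (Kinf_cont hα u).continuousAt
      exact Real.continuousAt_rpow_const _ _ (Or.inl hu.ne')
    refine (hc.tendsto.mono_left nhdsWithin_le_nhds).congr' ?_
    have h1 : ∀ᶠ w in 𝓝[≠] u, 0 < w := nhdsWithin_le_nhds (lt_mem_nhds hu)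
    filter_upwards [h1, self_mem_nhdsWithin] with w hw hne
    exact (off w hw (Ne.symm hne)).symm
  · exact off v hv h

lemma det_KB {α : ℝ} (hα : -1 < α) {n : ℕ} (t : Fin n → ℝ) (ht : ∀ i, 0 < t i) :
    Matrix.det (Matrix.of fun i j : Fin n => KBessel α (t i) (t j)) =
      (∏ i, t i ^ α) * Matrix.det (Matrix.of fun i j : Fin n => Kinf α (t i) (t j)) := by
  have h1 : (Matrix.of fun i j : Fin n => KBessel α (t i) (t j)) =
      Matrix.of fun i j : Fin n => t i ^ (α/2) * (Matrix.of fun i j : Fin n => t j ^ (α/2) *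
        (Matrix.of fun i j : Fin n => Kinf α (t i) (t j)) i j) i j := by
    ext i j
    simp only [Matrix.of_apply]
    rw [KB_eq hα (ht i) (ht j), mul_assoc]
  rw [h1, Matrix.det_mul_column, Matrix.det_mul_row, ← mul_assoc, ← Finset.prod_mul_distrib]
  congr 1
  refine Finset.prod_congr rfl fun i _ => ?_
  rw [← Real.rpow_add (ht i), add_halves]


lemma extFun_meas {X : Type*} [MeasurableSpace X] {n : ℕ} (g : X → Fin n → ℝ) (hg : Measurable g)
    (k : ℕ) : Measurable (fun x => extFun (g x) k) := by
  unfold extFun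
  split_ifs with h
  · exact (measurable_pi_apply _).comp hg
  · exact measurable_const

lemma fullVec_meas (N n : ℕ) (i : Fin N) :
    Measurable (fun p : (Fin n → ℝ) × (Fin (N - n) → ℝ) => fullVec N n p.1 p.2 i) := by
  unfold fullVec
  split_ifs with h
  · exact extFun_meas _ measurable_fst _
  · exact extFun_meas _ measurable_snd _

lemma meas_nonneg {X : Type*} [MeasurableSpace X] {n : ℕ} (g : X → Fin n → ℝ) (hg : Measurable g) :
    MeasurableSet {x | ∀ k, 0 ≤ g x k} := by
  have : {x | ∀ k, 0 ≤ g x k} = ⋂ k, {x | 0 ≤ g x k} := by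
    ext; simp
  rw [this]
  exact MeasurableSet.iInter fun k => measurableSet_le measurable_const
    ((measurable_pi_apply _).comp hg)

lemma btlueR_meas (α : ℝ) (N n : ℕ) (r : ℝ) : Measurable (btlueR α N n r) := by
  unfold btlueR
  refine Measurable.ite (meas_nonneg _ measurable_id) ?_ measurable_const
  refine Measurable.const_mul ?_ _
  have h : StronglyMeasurable (fun p : (Fin n → ℝ) × (Fin (N - n) → ℝ) =>
      (if (∀ k, 0 ≤ p.2 k) ∧ (∑ i, p.1 i) + (∑ k, p.2 k) ≤ r then
          vdm2 (fullVec N n p.1 p.2) * lagWeight α (fullVec N n p.1 p.2) else 0)) := by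
    refine Measurable.stronglyMeasurable ?_
    refine Measurable.ite ?_ ?_ measurable_const
    · refine (meas_nonneg _ measurable_snd).inter ?_
      exact measurableSet_le (f := fun p : (Fin n → ℝ) × (Fin (N - n) → ℝ) => (∑ i, p.1 i) + (∑ k, p.2 k))
        (by fun_prop) measurable_const
    · unfold vdm2 lagWeight
      refine Measurable.mul ?_ ?_
      · exact Finset.measurable_fun_prod _ fun p _ =>
          ((fullVec_meas N n _).sub (fullVec_meas N n _)).pow_const 2
      · exact Finset.measurable_fun_prod _ fun i _ => (fullVec_meas N n i).pow_const α
  exact h.integral_prod_right'.measurable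

/-- hard-edge universality of the bounded trace LUE (Bessel-kernel limit). -/
theorem btlue_hard_edge (α : ℝ) (hα : -1 < α) (n : ℕ) (hn : 1 ≤ n)
    (f : (Fin n → ℝ) → ℝ) (hf : Continuous f) (hsupp : HasCompactSupport f)
    (hpos : tsupport f ⊆ {t : Fin n → ℝ | ∀ i, 0 < t i}) :
    Tendsto (fun N : ℕ =>
        (∫ t : Fin n → ℝ, f t *
            btlueR α N n (((N : ℝ) + α) / 4)
              (fun i => t i / (16 * (N : ℝ) ^ 2))) /
          (16 * (N : ℝ) ^ 2) ^ n)
      atTop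
      (𝓝 (∫ t : Fin n → ℝ,
            f t * Matrix.det (Matrix.of fun i j : Fin n => KBessel α (t i) (t j)))) := by
  have hK : IsCompact (tsupport f) := hsupp
  obtain ⟨T, hT⟩ := hK.exists_bound_of_continuousOn (f := fun t : Fin n → ℝ => t)
    continuous_id.continuousOn
  obtain ⟨C2, hC2⟩ := hK.exists_bound_of_continuousOn (f := fun t : Fin n → ℝ => ∏ i, t i ^ α) (by
    refine continuousOn_finsetProd _ fun i _ => ?_
    exact (continuous_apply i).continuousOn.rpow_const fun t ht => Or.inl (hpos ht i).ne')
  obtain ⟨C, hC, hb⟩ := R_bound hα n (T := |T|) (abs_nonneg T)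
  simp_rw [← integral_div]
  refine tendsto_integral_filter_of_dominated_convergence (fun t => C * C2 * ‖f t‖) ?_ ?_ ?_ ?_
  · refine Eventually.of_forall fun N => Measurable.aestronglyMeasurable ?_
    refine (hf.measurable.mul ?_).div_const _
    exact (btlueR_meas α N n _).comp (by fun_prop)
  · filter_upwards [hb] with N hN
    refine Eventually.of_forall fun t => ?_
    by_cases ht : t ∈ tsupport f
    · have h1 := hN t fun i => ⟨hpos ht i,
        (le_abs_self _).trans (((norm_le_pi_norm t i).trans (hT t ht)).trans (le_abs_self T))⟩
      have h2 := (Real.le_norm_self _).trans (hC2 t ht)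
      rw [mul_div_assoc, norm_mul, mul_comm]
      exact mul_le_mul_of_nonneg_right (h1.trans (mul_le_mul_of_nonneg_left h2 hC)) (norm_nonneg _)
    · rw [image_eq_zero_of_notMem_tsupport ht]; simp
  · exact ((hf.integrable_of_hasCompactSupport hsupp).norm).const_mul _
  · refine Eventually.of_forall fun t => ?_
    by_cases ht : t ∈ tsupport f
    · rw [det_KB hα t (hpos ht)]
      simp_rw [mul_div_assoc]
      exact (R_lim hα t (hpos ht)).const_mul _
    · rw [image_eq_zero_of_notMem_tsupport ht]; simp

end RMT
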